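/- arXiv:1606.02815 — 2 statements merged into one kernel-verified Lean document; each statement's English description precedes it below -/
import Mathlib

section
/- Let G be a locally triangle-free graph in W₂ with α(G) ≥ 3, and let (abc) be a triangle in G such that G_{ab} ≠ ∅. If A = N_G(a) \ N_G[b] is not an independent set, then the induced subgraph G[A] consists of exactly one edge together with α(G) − 2 isolated vertices, and G_{ab} has exactly 2(α(G) − 2) vertices. -/
open Set

variable {V : Type*}

/-- `S` is an independent set of `G` contained in the vertex subset `W`
(i.e. an independent set of the induced subgraph `G[W]`). -/
def IsIndepOn (G : SimpleGraph V) (W S : Set V) : Prop :=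
  S ⊆ W ∧ ∀ ⦃x⦄, x ∈ S → ∀ ⦃y⦄, y ∈ S → ¬ G.Adj x y

/-- `S` is a maximal independent set of the induced subgraph `G[W]`. -/
def MaxIndepOn (G : SimpleGraph V) (W : Set V) (S : Finset V) : Prop :=
  IsIndepOn G W ↑S ∧ ∀ v ∈ W, v ∉ S → ¬ IsIndepOn G W (insert v ↑S)

/-- The independence number of the induced subgraph `G[W]`. -/
noncomputable def indepNumOn (G : SimpleGraph V) (W : Set V) : ℕ :=
  sSup {n | ∃ S : Finset V, IsIndepOn G W ↑S ∧ S.card = n}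

/-- The induced subgraph `G[W]` is well-covered: every maximal independent set
has cardinality equal to the independence number. -/
def WellCoveredOn (G : SimpleGraph V) (W : Set V) : Prop :=
  ∀ S : Finset V, MaxIndepOn G W S → S.card = indepNumOn G W

/-- The independence number `α(G)`. -/
noncomputable def indepNum (G : SimpleGraph V) : ℕ := indepNumOn G Set.univ

/-- `G` is well-covered. -/
def WellCovered (G : SimpleGraph V) : Prop := WellCoveredOn G Set.univ

/-- The induced subgraph `G[W]` has no isolated vertices. -/
def NoIsolatedOn (G : SimpleGraph V) (W : Set V) : Prop :=
  ∀ v ∈ W, ∃ u ∈ W, G.Adj v u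

/-- The induced subgraph `G[W]` is in the class `W₂`: it has no isolated
vertices, is well-covered, and removing any vertex leaves a well-covered graph
with the same independence number. -/
def W2On (G : SimpleGraph V) (W : Set V) : Prop :=
  NoIsolatedOn G W ∧ WellCoveredOn G W ∧
    ∀ v ∈ W, WellCoveredOn G (W \ {v}) ∧ indepNumOn G (W \ {v}) = indepNumOn G W

/-- `G` is in the class `W₂`. -/
def W2 (G : SimpleGraph V) : Prop := W2On G Set.univ

/-- The closed neighborhood `N_G[S]` of a set of vertices `S`. -/
def nbhd (G : SimpleGraph V) (S : Set V) : Set V :=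
  {v | v ∈ S ∨ ∃ u ∈ S, G.Adj u v}

/-- The vertex set of `G_S = G \ N_G[S]`. -/
def GDel (G : SimpleGraph V) (S : Set V) : Set V := Set.univ \ nbhd G S

/-- The induced subgraph `G[W]` is triangle-free. -/
def TriangleFreeOn (G : SimpleGraph V) (W : Set V) : Prop :=
  ∀ x ∈ W, ∀ y ∈ W, ∀ z ∈ W, ¬ (G.Adj x y ∧ G.Adj y z ∧ G.Adj x z)

/-- `G` is locally triangle-free: `G_v` is triangle-free for every vertex `v`. -/
def LocallyTriangleFree (G : SimpleGraph V) : Prop :=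
  ∀ v : V, TriangleFreeOn G (GDel G {v})

/-- `G` is a join of two proper (nonempty, disjoint) subgraphs. -/
def IsJoin (G : SimpleGraph V) : Prop :=
  ∃ V₁ V₂ : Set V, V₁.Nonempty ∧ V₂.Nonempty ∧ Disjoint V₁ V₂ ∧ V₁ ∪ V₂ = Set.univ ∧
    ∀ x ∈ V₁, ∀ y ∈ V₂, G.Adj x y

section Independent

variable {G : SimpleGraph V}

theorem isIndepOn_univ {S : Set V} :
    IsIndepOn G Set.univ S ↔ ∀ x ∈ S, ∀ y ∈ S, ¬ G.Adj x y := by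
  simp [IsIndepOn]

variable [Fintype V]

theorem IsIndepOn.card_le_indepNumOn {W : Set V} {S : Finset V} (hS : IsIndepOn G W ↑S) :
    S.card ≤ indepNumOn G W := by
  refine le_csSup ⟨Fintype.card V, ?_⟩ ⟨S, hS, rfl⟩
  rintro n ⟨T, -, rfl⟩
  exact Finset.card_le_univ T

theorem IsIndepOn.exists_maxIndepOn {W : Set V} {S : Finset V} (hS : IsIndepOn G W ↑S) :
    ∃ T : Finset V, S ⊆ T ∧ MaxIndepOn G W T := by
  classical
  obtain ⟨T, hST, hT⟩ :=
    (Set.toFinite {T : Finset V | IsIndepOn G W ↑T}).exists_le_maximal hS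
  refine ⟨T, hST, hT.prop, fun v _ hvT hv => hvT ?_⟩
  have hins : IsIndepOn G W ↑(insert v T) := by rwa [Finset.coe_insert]
  exact hT.le_of_ge hins (Finset.subset_insert v T) (Finset.mem_insert_self v T)

/-- In a graph of `W₂`, deleting the closed neighborhood of an independent set
leaves no isolated vertex. -/
theorem W2.exists_adj_of_notMem_nbhd (h2 : W2 G) {S : Finset V}
    (hS : IsIndepOn G Set.univ ↑S) {v : V} (hv : v ∉ nbhd G ↑S) :
    ∃ u ∉ nbhd G ↑S, G.Adj v u := by
  classical
  by_contra! hcon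
  have hvS : v ∉ S := fun h => hv (Or.inl h)
  obtain ⟨T, hST, hT⟩ := IsIndepOn.exists_maxIndepOn (G := G) (W := Set.univ \ {v}) (S := S)
    ⟨fun x hx => ⟨trivial, fun h => hvS (by simpa [← mem_singleton_iff.1 h] using hx)⟩, hS.2⟩
  have hcard := (h2.2.2 v trivial).1 T hT
  rw [(h2.2.2 v trivial).2] at hcard
  have hvT : v ∉ T := fun h => (hT.1.1 h).2 rfl
  have hadj : ∀ t ∈ T, ¬ G.Adj v t := by
    intro t ht hvt
    by_cases h : t ∈ nbhd G ↑S
    · rcases h with h | ⟨s, hs, hst⟩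
      · exact hv (Or.inr ⟨t, h, hvt.symm⟩)
      · exact hT.1.2 (hST hs) ht hst
    · exact hcon t h hvt
  have hins : IsIndepOn G Set.univ ↑(insert v T) := by
    rw [isIndepOn_univ]
    intro x hx y hy hxy
    simp only [Finset.coe_insert, Set.mem_insert_iff, Finset.mem_coe] at hx hy
    rcases hx with rfl | hx <;> rcases hy with rfl | hy
    · exact hxy.ne rfl
    · exact hadj y hy hxy
    · exact hadj x hx hxy.symm
    · exact hT.1.2 hx hy hxy
  have := hins.card_le_indepNumOn
  rw [Finset.card_insert_of_notMem hvT] at this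
  omega

/-- An independent set of a graph of `W₂` is maximum as soon as no edge avoids its closed
neighborhood. -/
theorem W2.card_eq_indepNum (h2 : W2 G) {S : Finset V}
    (hS : ∀ x ∈ S, ∀ y ∈ S, ¬ G.Adj x y)
    (hout : ∀ u v, G.Adj u v → u ∉ S → v ∉ S → (∃ s ∈ S, G.Adj s u) ∨ ∃ s ∈ S, G.Adj s v) :
    S.card = indepNum G := by
  have hS' : IsIndepOn G Set.univ ↑S := isIndepOn_univ.2 hS
  refine h2.2.1 S ⟨hS', fun v _ hvS hv => ?_⟩
  have hvn : v ∉ nbhd G ↑S := by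
    rintro (h | ⟨s, hs, hsv⟩)
    · exact hvS h
    · exact hv.2 (Set.mem_insert_of_mem _ hs) (Set.mem_insert _ _) hsv
  obtain ⟨u, hu, hvu⟩ := h2.exists_adj_of_notMem_nbhd hS' hvn
  rcases hout v u hvu hvS (fun h => hu (Or.inl h)) with ⟨s, hs, h⟩ | ⟨s, hs, h⟩
  · exact hvn (Or.inr ⟨s, hs, h⟩)
  · exact hu (Or.inr ⟨s, hs, h⟩)

/-- A maximum independent set dominates every other vertex. -/
theorem exists_adj_of_card_eq_indepNum {S : Finset V}
    (hS : ∀ x ∈ S, ∀ y ∈ S, ¬ G.Adj x y) (hcard : S.card = indepNum G) {v : V} (hv : v ∉ S) :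
    ∃ s ∈ S, G.Adj s v := by
  classical
  by_contra! hcon
  have hins : IsIndepOn G Set.univ ↑(insert v S) := by
    rw [isIndepOn_univ]
    intro x hx y hy hxy
    simp only [Finset.coe_insert, Set.mem_insert_iff, Finset.mem_coe] at hx hy
    rcases hx with rfl | hx <;> rcases hy with rfl | hy
    · exact hxy.ne rfl
    · exact hcon y hy hxy.symm
    · exact hcon x hx hxy
    · exact hS x hx y hy hxy
  have := hins.card_le_indepNumOn
  rw [Finset.card_insert_of_notMem hv] at this
  unfold indepNum at hcard
  omega

end Independent

section EdgeNeighborhood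

/-- `x` is a vertex of `N_G(a) \ N_G[b]`. -/
def IsPrivate (G : SimpleGraph V) (a b x : V) : Prop :=
  G.Adj a x ∧ ¬ G.Adj b x ∧ x ≠ b

/-- `xy` is an edge of the subgraph induced on `N_G(a) \ N_G[b]`. -/
def PrivateEdge (G : SimpleGraph V) (a b x y : V) : Prop :=
  IsPrivate G a b x ∧ IsPrivate G a b y ∧ G.Adj x y

open Classical in
/-- The neighbors of `x` among the common non-neighbors of `a` and `b`. -/
noncomputable def farNbrs [Fintype V] (G : SimpleGraph V) (a b x : V) : Finset V :=
  {z | ¬ G.Adj a z ∧ ¬ G.Adj b z ∧ G.Adj x z}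

variable {G : SimpleGraph V} {a b x y u v z : V}

theorem PrivateEdge.symm (h : PrivateEdge G a b x y) : PrivateEdge G a b y x :=
  ⟨h.2.1, h.1, h.2.2.symm⟩

theorem LocallyTriangleFree.adj_of_triangle (hloc : LocallyTriangleFree G) {x y w : V}
    (hxy : G.Adj x y) (hyw : G.Adj y w) (hxw : G.Adj x w) (z : V) :
    G.Adj z x ∨ G.Adj z y ∨ G.Adj z w := by
  by_contra! h
  have key : ∀ t, ¬ G.Adj z t → t ≠ z → t ∈ GDel G {z} := by
    intro t h1 h2
    simp [GDel, nbhd, h1, h2]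
  have hx : x ≠ z := by rintro rfl; exact h.2.1 hxy
  have hy : y ≠ z := by rintro rfl; exact h.2.2 hyw
  have hw : w ≠ z := by rintro rfl; exact h.1 hxw.symm
  exact hloc z x (key x h.1 hx) y (key y h.2.1 hy) w (key w h.2.2 hw) ⟨hxy, hyw, hxw⟩

theorem PrivateEdge.adj_or (h : PrivateEdge G a b x y) (hloc : LocallyTriangleFree G)
    (hz : ¬ G.Adj a z) : G.Adj x z ∨ G.Adj y z := by
  rcases hloc.adj_of_triangle h.1.1 h.2.2 h.2.1.1 z with h1 | h1 | h1
  · exact absurd h1.symm hz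
  · exact Or.inl h1.symm
  · exact Or.inr h1.symm

/-- The vertices of `G \ N_G[b]` span no triangle. -/
theorem LocallyTriangleFree.not_triangle (hloc : LocallyTriangleFree G) {x y z : V}
    (hx : ¬ G.Adj b x) (hy : ¬ G.Adj b y) (hz : ¬ G.Adj b z)
    (hxy : G.Adj x y) (hyz : G.Adj y z) : ¬ G.Adj x z := fun hxz => by
  have := hloc.adj_of_triangle hxy hyz hxz b
  tauto

variable [Fintype V]

theorem mem_farNbrs : z ∈ farNbrs G a b x ↔ ¬ G.Adj a z ∧ ¬ G.Adj b z ∧ G.Adj x z := by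
  simp [farNbrs]

/-- An edge `xy` of `G[A]` gives the independent set `(N(x) ∩ V(G_{ab})) ∪ {y, b}`. -/
theorem PrivateEdge.indep_insert (h : PrivateEdge G a b x y) (hloc : LocallyTriangleFree G)
    [DecidableEq V] :
    ∀ s ∈ insert y (insert b (farNbrs G a b x)), ∀ t ∈ insert y (insert b (farNbrs G a b x)),
      ¬ G.Adj s t := by
  obtain ⟨⟨hax, hbx, hxb⟩, ⟨hay, hby, hyb⟩, hxy⟩ := h
  have tf := fun p q r => hloc.not_triangle (b := b) (x := p) (y := q) (z := r)
  intro s hs t ht hst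
  simp only [Finset.mem_insert, mem_farNbrs] at hs ht
  grind [G.adj_comm, G.irrefl]

theorem PrivateEdge.card_insert (h : PrivateEdge G a b x y) (hab : G.Adj a b)
    [DecidableEq V] : (insert y (insert b (farNbrs G a b x))).card =
      (farNbrs G a b x).card + 2 := by
  obtain ⟨⟨hax, hbx, hxb⟩, ⟨hay, hby, hyb⟩, hxy⟩ := h
  rw [Finset.card_insert_of_notMem, Finset.card_insert_of_notMem]
  · simp only [mem_farNbrs]; tauto
  · simp only [Finset.mem_insert, mem_farNbrs]; tauto

theorem PrivateEdge.card_farNbrs_of_nonempty (h : PrivateEdge G a b x y)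
    (hloc : LocallyTriangleFree G) (h2 : W2 G) (hab : G.Adj a b)
    (hne : (farNbrs G a b x).Nonempty) : (farNbrs G a b x).card + 2 = indepNum G := by
  classical
  rw [← h.card_insert hab]
  refine h2.card_eq_indepNum (h.indep_insert hloc) ?_
  intro u v huv hu hv
  by_contra! hcon
  simp only [Finset.mem_insert, mem_farNbrs, forall_eq_or_imp] at hcon hu hv
  obtain ⟨z, hz⟩ := hne
  rw [mem_farNbrs] at hz
  have hu' : G.Adj a u := by
    by_contra hau
    have := h.adj_or hloc hau
    tauto
  have hv' : G.Adj a v := by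
    by_contra hav
    have := h.adj_or hloc hav
    tauto
  have huv' : PrivateEdge G a b u v := ⟨⟨hu', by tauto, by tauto⟩, ⟨hv', by tauto, by tauto⟩, huv⟩
  rcases huv'.adj_or hloc hz.1 with h' | h'
  · exact hcon.1.2.2 z hz h'.symm
  · exact hcon.2.2.2 z hz h'.symm

theorem PrivateEdge.farNbrs_nonempty (h : PrivateEdge G a b x y)
    (hloc : LocallyTriangleFree G) (h2 : W2 G)
    (hne : (GDel G {a, b}).Nonempty) : (farNbrs G a b x).Nonempty := by
  classical
  by_contra hemp
  rw [Finset.not_nonempty_iff_eq_empty] at hemp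
  obtain ⟨z, hz⟩ := hne
  have hz' : ¬ G.Adj a z ∧ ¬ G.Adj b z := by
    simp [GDel, nbhd] at hz; tauto
  have hx0 : ∀ t, ¬ G.Adj a t → ¬ G.Adj b t → ¬ G.Adj x t := fun t h1 h2 h3 => by
    have : t ∈ farNbrs G a b x := mem_farNbrs.2 ⟨h1, h2, h3⟩
    simp [hemp] at this
  have hind : ∀ s ∈ insert b (farNbrs G a b y), ∀ t ∈ insert b (farNbrs G a b y),
      ¬ G.Adj s t := fun s hs t ht =>
    h.symm.indep_insert hloc s (Finset.mem_insert_of_mem hs) t (Finset.mem_insert_of_mem ht)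
  have hxn : x ∉ nbhd G ↑(insert b (farNbrs G a b y)) := by
    obtain ⟨⟨hax, hbx, hxb⟩, ⟨hay, hby, hyb⟩, hxy⟩ := h
    simp only [nbhd, Finset.coe_insert, Set.mem_ofPred_eq, Set.mem_insert_iff, Finset.mem_coe,
      mem_farNbrs]
    rintro (h' | ⟨s, rfl | hs, h'⟩)
    · tauto
    · tauto
    · exact hx0 s hs.1 hs.2.1 h'.symm
  obtain ⟨u, hu, hxu⟩ := h2.exists_adj_of_notMem_nbhd (isIndepOn_univ.2 hind) hxn
  simp only [nbhd, Finset.coe_insert, Set.mem_ofPred_eq, Set.mem_insert_iff, Finset.mem_coe,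
    mem_farNbrs, not_or, not_exists, not_and] at hu
  have hbu : ¬ G.Adj b u := hu.2 b (Or.inl rfl)
  have hau : G.Adj a u := by
    by_contra hau
    exact hx0 u hau hbu hxu
  have hxu' : PrivateEdge G a b x u := ⟨h.1, ⟨hau, hbu, hu.1.1⟩, hxu⟩
  have h3 := hx0 z hz'.1 hz'.2
  have hyz := (h.adj_or hloc hz'.1).resolve_left h3
  have huz := (hxu'.adj_or hloc hz'.1).resolve_left h3
  exact hu.2 z (Or.inr ⟨hz'.1, hz'.2, hyz⟩) huz.symm

theorem PrivateEdge.card_farNbrs (h : PrivateEdge G a b x y)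
    (hloc : LocallyTriangleFree G) (h2 : W2 G) (hab : G.Adj a b)
    (hne : (GDel G {a, b}).Nonempty) : (farNbrs G a b x).card + 2 = indepNum G :=
  h.card_farNbrs_of_nonempty hloc h2 hab (h.farNbrs_nonempty hloc h2 hne)

theorem PrivateEdge.exists_farNbrs_adj (h : PrivateEdge G a b x y)
    (hloc : LocallyTriangleFree G) (h2 : W2 G) (hab : G.Adj a b)
    (hne : (GDel G {a, b}).Nonempty) (hu : IsPrivate G a b u) (huy : u ≠ y)
    (hyu : ¬ G.Adj y u) : ∃ z ∈ farNbrs G a b x, G.Adj u z := by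
  classical
  have hu' : u ∉ insert y (insert b (farNbrs G a b x)) := by
    have := hu.1
    have := hu.2.2
    simp only [Finset.mem_insert, mem_farNbrs]
    tauto
  obtain ⟨s, hs, hsu⟩ := exists_adj_of_card_eq_indepNum (h.indep_insert hloc)
    ((h.card_insert hab).trans (h.card_farNbrs hloc h2 hab hne)) hu'
  simp only [Finset.mem_insert] at hs
  rcases hs with rfl | rfl | hs
  · exact absurd hsu hyu
  · exact absurd hsu hu.2.1
  · exact ⟨s, hs, hsu.symm⟩

theorem PrivateEdge.right_unique (h : PrivateEdge G a b x y)
    (hloc : LocallyTriangleFree G) (h2 : W2 G) (hab : G.Adj a b)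
    (hne : (GDel G {a, b}).Nonempty) (h' : PrivateEdge G a b x u) : u = y := by
  by_contra huy
  have hyu : ¬ G.Adj y u :=
    hloc.not_triangle h.2.1.2.1 h.1.2.1 h'.2.1.2.1 h.2.2.symm h'.2.2
  obtain ⟨z, hz, huz⟩ := h.exists_farNbrs_adj hloc h2 hab hne h'.2.1 huy hyu
  rw [mem_farNbrs] at hz
  exact hloc.not_triangle h'.1.2.1 h'.2.1.2.1 hz.2.1 h'.2.2 huz hz.2.2

theorem PrivateEdge.not_adj (h : PrivateEdge G a b x y)
    (hloc : LocallyTriangleFree G) (h2 : W2 G) (hab : G.Adj a b)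
    (hne : (GDel G {a, b}).Nonempty) (hu : IsPrivate G a b u) (huy : u ≠ y) : ¬ G.Adj x u :=
  fun hxu => huy (h.right_unique hloc h2 hab hne ⟨h.1, hu, hxu⟩)

open Classical in
theorem PrivateEdge.card_inter_farNbrs (h : PrivateEdge G a b x y) (h' : PrivateEdge G a b u v)
    (hloc : LocallyTriangleFree G) (h2 : W2 G) (hab : G.Adj a b)
    (hne : (GDel G {a, b}).Nonempty) (hux : u ≠ x) (huy : u ≠ y) :
    (farNbrs G a b y ∩ farNbrs G a b v).card + 3 = indepNum G := by
  have hvx : v ≠ x := by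
    rintro rfl
    exact huy (h.right_unique hloc h2 hab hne h'.symm)
  have hxu := h.not_adj hloc h2 hab hne h'.1 huy
  have hyu := h.symm.not_adj hloc h2 hab hne h'.1 hux
  have hyv := h.symm.not_adj hloc h2 hab hne h'.2.1 hvx
  obtain ⟨z, hz, hvz⟩ := h.symm.exists_farNbrs_adj hloc h2 hab hne h'.2.1 hvx
    (h.not_adj hloc h2 hab hne h'.2.1 (by
      rintro rfl
      exact hux (h.symm.right_unique hloc h2 hab hne h'.symm)))
  rw [← h2.card_eq_indepNum
    (S := insert x (insert u (insert b (farNbrs G a b y ∩ farNbrs G a b v))))]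
  · rw [Finset.card_insert_of_notMem, Finset.card_insert_of_notMem, Finset.card_insert_of_notMem]
    · simp only [Finset.mem_inter, mem_farNbrs]; tauto
    · have := h'.1.1
      have := h'.1.2.2
      simp only [Finset.mem_insert, Finset.mem_inter, mem_farNbrs]; tauto
    · have := h.1.1
      have := h.1.2.2
      simp only [Finset.mem_insert, Finset.mem_inter, mem_farNbrs]
      rintro (h1 | h1 | h1)
      · exact hux h1.symm
      · tauto
      · tauto
  · intro s hs t ht hst
    have hS := h.symm.indep_insert hloc
    have hS' := h'.symm.indep_insert hloc
    simp only [Finset.mem_insert, Finset.mem_inter] at hs ht hS hS'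
    rcases hs with rfl | rfl | hs <;> rcases ht with rfl | rfl | ht
    all_goals first
      | exact hst.ne rfl
      | exact hxu hst
      | exact hxu hst.symm
      | exact hS _ (by tauto) _ (by tauto) hst
      | exact hS' _ (by tauto) _ (by tauto) hst
  · intro p q hpq hp hq
    by_contra! hcon
    simp only [Finset.mem_insert, Finset.mem_inter, mem_farNbrs, forall_eq_or_imp] at hcon hp hq
    rw [mem_farNbrs] at hz
    have hpa : G.Adj a p := by
      by_contra hn
      have := h.adj_or hloc hn
      have := h'.adj_or hloc hn
      tauto
    have hqa : G.Adj a q := by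
      by_contra hn
      have := h.adj_or hloc hn
      have := h'.adj_or hloc hn
      tauto
    have hpq' : PrivateEdge G a b p q :=
      ⟨⟨hpa, by tauto, by tauto⟩, ⟨hqa, by tauto, by tauto⟩, hpq⟩
    rcases hpq'.adj_or hloc hz.1 with h1 | h1
    · exact hcon.1.2.2.2 z ⟨hz, hz.1, hz.2.1, hvz⟩ h1.symm
    · exact hcon.2.2.2.2 z ⟨hz, hz.1, hz.2.1, hvz⟩ h1.symm

theorem PrivateEdge.exists_isPrivate_adj (h : PrivateEdge G a b x y) (h' : PrivateEdge G a b u v)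
    (hloc : LocallyTriangleFree G) (h2 : W2 G) (hxu : ¬ G.Adj x u) {q : V}
    (hqy : q ∈ farNbrs G a b y) (hqv : q ∈ farNbrs G a b v) :
    ∃ w, IsPrivate G a b w ∧ G.Adj q w ∧ w ≠ x ∧ w ≠ u ∧ ¬ G.Adj x w ∧ ¬ G.Adj u w := by
  classical
  rw [mem_farNbrs] at hqy hqv
  have hxq : ¬ G.Adj x q :=
    hloc.not_triangle h.1.2.1 h.2.1.2.1 hqy.2.1 h.2.2 hqy.2.2
  have huq : ¬ G.Adj u q :=
    hloc.not_triangle h'.1.2.1 h'.2.1.2.1 hqy.2.1 h'.2.2 hqv.2.2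
  have hind : IsIndepOn G Set.univ ↑({b, x, u} : Finset V) := by
    rw [isIndepOn_univ]
    have := h.1.2.1
    have := h'.1.2.1
    simp only [Finset.coe_insert, Finset.coe_singleton, Set.mem_insert_iff, Set.mem_singleton_iff]
    rintro s (rfl | rfl | rfl) t (rfl | rfl | rfl) hst
    all_goals first
      | exact hst.ne rfl
      | exact absurd hst ‹_›
      | exact absurd hst.symm ‹_›
  obtain ⟨w, hw, hqw⟩ := h2.exists_adj_of_notMem_nbhd hind (v := q) (by
    have := h.1.1
    have := h'.1.1
    simp only [nbhd, Finset.coe_insert, Finset.coe_singleton, Set.mem_ofPred_eq,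
      Set.mem_insert_iff, Set.mem_singleton_iff, exists_eq_or_imp, exists_eq_left]
    rintro ((rfl | rfl | rfl) | h1 | h1 | h1)
    · exact h.2.1.2.1 hqy.2.2.symm
    all_goals tauto)
  simp only [nbhd, Finset.coe_insert, Finset.coe_singleton, Set.mem_ofPred_eq,
    Set.mem_insert_iff, Set.mem_singleton_iff, exists_eq_or_imp, exists_eq_left, not_or] at hw
  obtain ⟨⟨hwb, hwx, hwu⟩, hbw, hxw, huw⟩ := hw
  refine ⟨w, ⟨?_, hbw, hwb⟩, hqw, hwx, hwu, hxw, huw⟩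
  by_contra haw
  exact hloc.not_triangle h.2.1.2.1 hqy.2.1 hbw hqy.2.2 hqw
    ((h.adj_or hloc haw).resolve_left hxw)

open Classical in
theorem PrivateEdge.not_adj_of_indepNum_eq_four (h : PrivateEdge G a b x y)
    (h' : PrivateEdge G a b u v) (hloc : LocallyTriangleFree G) (h2 : W2 G) (hab : G.Adj a b)
    (hne : (GDel G {a, b}).Nonempty) (hux : u ≠ x) (huy : u ≠ y) (hα : indepNum G = 4)
    {p q : V} (hp : p ∈ farNbrs G a b x ∩ farNbrs G a b u)
    (hq : q ∈ farNbrs G a b y ∩ farNbrs G a b v) : ¬ G.Adj p q := by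
  intro hpq
  have hvx : v ≠ x := by
    rintro rfl
    exact huy (h.right_unique hloc h2 hab hne h'.symm)
  have hvy : v ≠ y := by
    rintro rfl
    exact hux (h.symm.right_unique hloc h2 hab hne h'.symm)
  have hxu := h.not_adj hloc h2 hab hne h'.1 huy
  have hyv := h.symm.not_adj hloc h2 hab hne h'.2.1 hvx
  have hcard := h.symm.card_inter_farNbrs h'.symm hloc h2 hab hne hvy hvx
  rw [Finset.mem_inter] at hp hq
  obtain ⟨w, hw, hqw, hwx, hwu, hxw, huw⟩ :=
    h.exists_isPrivate_adj h' hloc h2 hxu hq.1 hq.2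
  obtain ⟨w', hw', hpw', hwy', hwv', hyw', hvw'⟩ :=
    h.symm.exists_isPrivate_adj h'.symm hloc h2 hyv hp.1 hp.2
  have hwy : w ≠ y := fun e => hxw (e ▸ h.2.2)
  have hwv : w ≠ v := fun e => huw (e ▸ h'.2.2)
  have hwx' : w' ≠ x := fun e => hyw' (e ▸ h.2.2.symm)
  have hwu' : w' ≠ u := fun e => hvw' (e ▸ h'.2.2.symm)
  have hqΓ := mem_farNbrs.1 hq.1
  have hpΓ := mem_farNbrs.1 hp.1
  have hpw : ¬ G.Adj p w := hloc.not_triangle hpΓ.2.1 hqΓ.2.1 hw.2.1 hpq hqw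
  have hww : w' ≠ w := fun e => hpw (e ▸ hpw')
  have hadj : G.Adj w w' := by
    obtain ⟨s, hs, hsw⟩ := exists_adj_of_card_eq_indepNum (G := G) (S := {b, x, u, w}) (v := w')
      (by
        have := h.1.2.1
        have := h'.1.2.1
        have := hw.2.1
        simp only [Finset.mem_insert, Finset.mem_singleton]
        rintro s (rfl | rfl | rfl | rfl) t (rfl | rfl | rfl | rfl) hst
        all_goals first
          | exact hst.ne rfl
          | exact absurd hst ‹_›
          | exact absurd hst.symm ‹_›)
      (by
        rw [hα]
        exact Finset.card_eq_succ.2 ⟨b, {x, u, w}, by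
          simp [h.1.2.2.symm, h'.1.2.2.symm, hw.2.2.symm], rfl,
          Finset.card_eq_three.2 ⟨x, u, w, hux.symm, hwx.symm, hwu.symm, rfl⟩⟩)
      (by simp [hw'.2.2, hwx', hwu', hww])
    simp only [Finset.mem_insert, Finset.mem_singleton] at hs
    rcases hs with rfl | rfl | rfl | rfl
    · exact absurd hsw hw'.2.1
    · exact absurd hsw (h.not_adj hloc h2 hab hne hw' hwy')
    · exact absurd hsw (h'.not_adj hloc h2 hab hne hw' hwv')
    · exact hsw
  have hedge : PrivateEdge G a b w w' := ⟨hw, hw', hadj⟩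
  obtain ⟨r, hr, hwr⟩ := h.exists_farNbrs_adj hloc h2 hab hne hw hwy
    (h.symm.not_adj hloc h2 hab hne hw hwx)
  obtain ⟨s, hs, hws⟩ := h'.exists_farNbrs_adj hloc h2 hab hne hw hwv
    (h'.symm.not_adj hloc h2 hab hne hw hwu)
  have huniq : ∀ t, t ∈ farNbrs G a b x → t ∈ farNbrs G a b u → G.Adj w t → False := by
    intro t htx htu hwt
    have : t = p := Finset.card_le_one.1 (by omega) t (Finset.mem_inter.2 ⟨htx, htu⟩) p
      (Finset.mem_inter.2 hp)
    exact hpw (this ▸ hwt.symm)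
  have hrΓ := mem_farNbrs.1 hr
  have hsΓ := mem_farNbrs.1 hs
  have hxq : ¬ G.Adj x q := hloc.not_triangle h.1.2.1 h.2.1.2.1 hqΓ.2.1 h.2.2 hqΓ.2.2
  have huq : ¬ G.Adj u q :=
    hloc.not_triangle h'.1.2.1 h'.2.1.2.1 hqΓ.2.1 h'.2.2 (mem_farNbrs.1 hq.2).2.2
  have hrs : r ≠ s := by
    rintro rfl
    exact huniq r hr hs hwr
  have hrq : r ≠ q := fun e => hxq (e ▸ hrΓ.2.2)
  have hsq : s ≠ q := fun e => huq (e ▸ hsΓ.2.2)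
  have hsub : ({r, s, q} : Finset V) ⊆ farNbrs G a b w := by
    intro t ht
    simp only [Finset.mem_insert, Finset.mem_singleton] at ht
    rw [mem_farNbrs]
    rcases ht with rfl | rfl | rfl
    · exact ⟨hrΓ.1, hrΓ.2.1, hwr⟩
    · exact ⟨hsΓ.1, hsΓ.2.1, hws⟩
    · exact ⟨hqΓ.1, hqΓ.2.1, hqw.symm⟩
  have h3 := Finset.card_le_card hsub
  rw [Finset.card_eq_three.2 ⟨r, s, q, hrs, hrq, hsq, rfl⟩] at h3
  have := hedge.card_farNbrs hloc h2 hab hne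
  omega

theorem PrivateEdge.disjoint_farNbrs (h : PrivateEdge G a b x y) (hloc : LocallyTriangleFree G) :
    Disjoint (farNbrs G a b x) (farNbrs G a b y) := by
  rw [Finset.disjoint_left]
  intro z hzx hzy
  rw [mem_farNbrs] at hzx hzy
  exact hloc.not_triangle h.1.2.1 h.2.1.2.1 hzx.2.1 h.2.2 hzy.2.2 hzx.2.2

/-- The subgraph induced on `N_G(a) \ N_G[b]` has at most one edge. -/
theorem PrivateEdge.eq_or_eq (h : PrivateEdge G a b x y)
    (h' : PrivateEdge G a b u v) (hloc : LocallyTriangleFree G) (h2 : W2 G) (hab : G.Adj a b)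
    (hne : (GDel G {a, b}).Nonempty) : u = x ∨ u = y := by
  classical
  by_contra! hu
  obtain ⟨hux, huy⟩ := hu
  have hvx : v ≠ x := by
    rintro rfl
    exact huy (h.right_unique hloc h2 hab hne h'.symm)
  have hvy : v ≠ y := by
    rintro rfl
    exact hux (h.symm.right_unique hloc h2 hab hne h'.symm)
  have hx := h.card_farNbrs hloc h2 hab hne
  have hy := h.symm.card_farNbrs hloc h2 hab hne
  have hxu := h.symm.card_inter_farNbrs h'.symm hloc h2 hab hne hvy hvx
  have hxv := h.symm.card_inter_farNbrs h' hloc h2 hab hne huy hux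
  have hsplit : ∀ z, z ∈ farNbrs G a b x ∨ z ∈ farNbrs G a b y →
      z ∈ farNbrs G a b u ∨ z ∈ farNbrs G a b v := by
    intro z hz
    simp only [mem_farNbrs] at hz ⊢
    have := h'.adj_or (z := z) hloc (by tauto)
    tauto
  have hunion : farNbrs G a b x =
      (farNbrs G a b x ∩ farNbrs G a b u) ∪ (farNbrs G a b x ∩ farNbrs G a b v) := by
    ext z
    have := hsplit z
    simp only [Finset.mem_union, Finset.mem_inter]
    tauto
  have hcard := congrArg Finset.card hunion
  rw [Finset.card_union_of_disjoint
    ((h'.disjoint_farNbrs hloc).mono Finset.inter_subset_right Finset.inter_subset_right)] at hcard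
  have hα : indepNum G = 4 := by omega
  have hindep : ∀ {s t : V} (p q), PrivateEdge G a b s t → p ∈ farNbrs G a b s →
      q ∈ farNbrs G a b s → ¬ G.Adj p q := by
    intro s t p q hst hp hq
    have := hst.indep_insert hloc
    exact this p (by simp [hp]) q (by simp [hq])
  have hcross : ∀ p ∈ farNbrs G a b x, ∀ q ∈ farNbrs G a b y, ¬ G.Adj p q := by
    intro p hp q hq
    rcases hsplit p (Or.inl hp) with hp' | hp' <;> rcases hsplit q (Or.inr hq) with hq' | hq'
    · exact hindep p q h' hp' hq'
    · exact h.not_adj_of_indepNum_eq_four h' hloc h2 hab hne hux huy hα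
        (Finset.mem_inter.2 ⟨hp, hp'⟩) (Finset.mem_inter.2 ⟨hq, hq'⟩)
    · exact h.not_adj_of_indepNum_eq_four h'.symm hloc h2 hab hne hvx hvy hα
        (Finset.mem_inter.2 ⟨hp, hp'⟩) (Finset.mem_inter.2 ⟨hq, hq'⟩)
    · exact hindep p q h'.symm hp' hq'
  have hind : IsIndepOn G Set.univ ↑(insert b (farNbrs G a b x ∪ farNbrs G a b y)) := by
    rw [isIndepOn_univ]
    intro p hp q hq hpq
    simp only [Finset.coe_insert, Set.mem_insert_iff, Finset.mem_coe, Finset.mem_union] at hp hq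
    have hb : ∀ t, t ∈ farNbrs G a b x ∨ t ∈ farNbrs G a b y → ¬ G.Adj b t := by
      intro t ht
      simp only [mem_farNbrs] at ht
      tauto
    rcases hp with rfl | hp
    · rcases hq with rfl | hq
      · exact hpq.ne rfl
      · exact hb q hq hpq
    rcases hq with rfl | hq
    · exact hb p hp hpq.symm
    rcases hp with hp | hp <;> rcases hq with hq | hq
    · exact hindep p q h hp hq hpq
    · exact hcross p hp q hq hpq
    · exact hcross q hq p hp hpq.symm
    · exact hindep p q h.symm hp hq hpq
  have hle := hind.card_le_indepNumOn
  rw [Finset.card_insert_of_notMem (by simp only [Finset.mem_union, mem_farNbrs]; tauto),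
    Finset.card_union_of_disjoint (h.disjoint_farNbrs hloc)] at hle
  unfold indepNum at hx hy hα
  omega

end EdgeNeighborhood

/-- If `A = N_G(a) \ N_G[b]` is not independent, then `G[A]` consists of one
edge together with `α(G) - 2` isolated vertices, and `G_{ab}` has
`2(α(G) - 2)` vertices. -/
theorem stmt_11 [Fintype V] (G : SimpleGraph V) (h2 : W2 G)
    (hloc : LocallyTriangleFree G) (hα : 3 ≤ indepNum G)
    {a b c : V} (hab : G.Adj a b) (hbc : G.Adj b c) (hac : G.Adj a c)
    (hne : (GDel G {a, b}).Nonempty)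
    (hA : ¬ IsIndepOn G Set.univ (G.neighborSet a \ nbhd G {b})) :
    (∃ x y, x ∈ G.neighborSet a \ nbhd G {b} ∧ y ∈ G.neighborSet a \ nbhd G {b} ∧
      G.Adj x y ∧
      (∀ u ∈ G.neighborSet a \ nbhd G {b}, ∀ w ∈ G.neighborSet a \ nbhd G {b},
        G.Adj u w → (u = x ∧ w = y) ∨ (u = y ∧ w = x)) ∧
      ((G.neighborSet a \ nbhd G {b}) \ {x, y}).ncard = indepNum G - 2) ∧
    (GDel G {a, b}).ncard = 2 * (indepNum G - 2) := by
  classical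
  have hmem : ∀ w, w ∈ G.neighborSet a \ nbhd G {b} ↔ IsPrivate G a b w := by
    intro w
    simp only [IsPrivate, nbhd, Set.mem_sdiff, SimpleGraph.mem_neighborSet, Set.mem_ofPred_eq,
      Set.mem_singleton_iff, exists_eq_left]
    tauto
  rw [isIndepOn_univ] at hA
  push Not at hA
  simp only [hmem] at hA ⊢
  obtain ⟨x, hx, y, hy, hxy⟩ := hA
  have h : PrivateEdge G a b x y := ⟨hx, hy, hxy⟩
  have hfar := h.card_farNbrs hloc h2 hab hne
  have hfar' := h.symm.card_farNbrs hloc h2 hab hne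
  refine ⟨⟨x, y, hx, hy, hxy, ?_, ?_⟩, ?_⟩
  · intro u hu w hw huw
    have h' : PrivateEdge G a b u w := ⟨hu, hw, huw⟩
    rcases h.eq_or_eq h' hloc h2 hab hne with rfl | rfl
    · exact Or.inl ⟨rfl, h.right_unique hloc h2 hab hne h'⟩
    · exact Or.inr ⟨rfl, h.symm.right_unique hloc h2 hab hne h'⟩
  · have hbx : b ≠ x := hx.2.2.symm
    set I : Finset V := {w | IsPrivate G a b w ∧ w ≠ x ∧ w ≠ y} with hI
    have hIset : (G.neighborSet a \ nbhd G {b}) \ {x, y} = ↑I := by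
      ext w
      rw [Set.mem_sdiff, hmem]
      simp [hI]
    have hmemI : ∀ w, w ∈ I ↔ IsPrivate G a b w ∧ w ≠ x ∧ w ≠ y := by simp [hI]
    rw [hIset, Set.ncard_coe_finset]
    have hcard : (insert b (insert x I)).card = indepNum G := by
      refine h2.card_eq_indepNum ?_ ?_
      · have hpriv : ∀ s t, (s = x ∨ s ∈ I) → (t = x ∨ t ∈ I) → ¬ G.Adj s t := by
          intro s t hs ht hst
          rw [hmemI] at hs ht
          have hs' : IsPrivate G a b s := by
            rcases hs with rfl | hs
            · exact hx
            · exact hs.1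
          have ht' : IsPrivate G a b t := by
            rcases ht with rfl | ht
            · exact hx
            · exact ht.1
          have h' : PrivateEdge G a b s t := ⟨hs', ht', hst⟩
          have h1 := h.eq_or_eq h' hloc h2 hab hne
          have h3 := h.eq_or_eq h'.symm hloc h2 hab hne
          have hxy' := hxy.ne
          have hst' := hst.ne
          grind
        have hb : ∀ t, (t = x ∨ t ∈ I) → ¬ G.Adj b t := by
          rintro t (rfl | ht)
          · exact hx.2.1
          · exact ((hmemI t).1 ht).1.2.1
        intro s hs t ht hst
        rw [Finset.mem_insert, Finset.mem_insert] at hs ht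
        rcases hs with rfl | hs <;> rcases ht with rfl | ht
        · exact hst.ne rfl
        · exact hb t ht hst
        · exact hb s hs hst.symm
        · exact hpriv s t hs ht hst
      · intro u v huv hu hv
        by_contra! hcon
        simp only [Finset.mem_insert, forall_eq_or_imp] at hcon hu hv
        have key : ∀ t, ¬ (t = b ∨ t = x ∨ t ∈ I) → ¬ G.Adj b t → ¬ G.Adj x t →
            ¬ G.Adj a t := by
          intro t ht hbt hxt hat
          rw [hmemI] at ht
          refine hxt ?_
          have hty : t = y := by
            by_contra hty
            exact ht (Or.inr (Or.inr ⟨⟨hat, hbt, by tauto⟩, by tauto, hty⟩))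
          exact hty ▸ hxy
        have hau := key u hu hcon.1.1 hcon.1.2.1
        have hav := key v hv hcon.2.1 hcon.2.2.1
        have hyu := (h.adj_or hloc hau).resolve_left hcon.1.2.1
        have hyv := (h.adj_or hloc hav).resolve_left hcon.2.2.1
        exact hloc.not_triangle hy.2.1 hcon.1.1 hcon.2.1 hyu huv hyv
    rw [Finset.card_insert_of_notMem, Finset.card_insert_of_notMem] at hcard
    · omega
    · simp [hmemI]
    · simp [hmemI, hbx, IsPrivate]
  · have hset : GDel G {a, b} = ↑(farNbrs G a b x ∪ farNbrs G a b y) := by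
      ext z
      simp only [GDel, nbhd, Set.mem_sdiff, Set.mem_univ, true_and, Set.mem_ofPred_eq,
        Set.mem_insert_iff, Set.mem_singleton_iff, exists_eq_or_imp, exists_eq_left,
        Finset.coe_union, Set.mem_union, Finset.mem_coe, mem_farNbrs]
      have hor := h.adj_or (z := z) hloc
      constructor
      · tauto
      · rintro hz ((rfl | rfl) | hz')
        · exact absurd hab.symm (by tauto)
        · exact absurd hab (by tauto)
        · tauto
    rw [hset, Set.ncard_coe_finset, Finset.card_union_of_disjoint (h.disjoint_farNbrs hloc)]
    omega
end

section
/- Let G be a locally triangle-free graph in W₂ with α(G) ≥ 3 that is not a join of two proper subgraphs, containing a triangle (abc), and set A = N_G(a) \ N_G[b]. If A is not an independent set of G, then α(G) = 3, the induced subgraph G[A] is one edge plus one isolated vertex, and G_{ab} = G \ N_G[{a,b}] consists of exactly two isolated vertices. -/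
open Set

variable {V : Type*}

open Classical in
/-- The purely combinatorial consequences of being a locally triangle-free graph of `W₂` with
independence number `n`: bounded and extendable independent sets, no isolated vertex in the
graphs `G_S`, and every vertex adjacent to at least one vertex of every triangle. -/
structure IsLocW2 (G : SimpleGraph V) (n : ℕ) : Prop where
  card_le : ∀ S : Finset V, (∀ u ∈ S, ∀ v ∈ S, ¬ G.Adj u v) → S.card ≤ n
  exists_far : ∀ S : Finset V, (∀ u ∈ S, ∀ v ∈ S, ¬ G.Adj u v) → S.card < n →
    ∃ v ∉ S, ∀ u ∈ S, ¬ G.Adj u v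
  exists_adj : ∀ (S : Finset V) (v : V), (∀ u ∈ S, ∀ w ∈ S, ¬ G.Adj u w) → v ∉ S →
    (∀ u ∈ S, ¬ G.Adj u v) → ∃ w ∉ S, (∀ u ∈ S, ¬ G.Adj u w) ∧ G.Adj v w
  dom : ∀ p q r : V, G.Adj p q → G.Adj q r → G.Adj p r →
    ∀ v, G.Adj v p ∨ G.Adj v q ∨ G.Adj v r

open Classical in
theorem indep_insert {G : SimpleGraph V} {S : Finset V} {v : V}
    (hS : ∀ u ∈ S, ∀ w ∈ S, ¬ G.Adj u w) (hfar : ∀ u ∈ S, ¬ G.Adj u v) :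
    ∀ u ∈ insert v S, ∀ w ∈ insert v S, ¬ G.Adj u w := by
  simp only [Finset.mem_insert, forall_eq_or_imp, SimpleGraph.irrefl, not_false_eq_true, true_and]
  exact ⟨fun u hu h => hfar u hu h.symm, fun u hu => ⟨hfar u hu, hS u hu⟩⟩

theorem exists_maximal_indep [Fintype V] (G : SimpleGraph V) (W : V → Prop) (S : Finset V)
    (hS : ∀ u ∈ S, ∀ v ∈ S, ¬ G.Adj u v) (hW : ∀ u ∈ S, W u) :
    ∃ T : Finset V, S ⊆ T ∧ (∀ u ∈ T, ∀ v ∈ T, ¬ G.Adj u v) ∧ (∀ u ∈ T, W u) ∧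
      ∀ v, W v → v ∉ T → ∃ u ∈ T, G.Adj u v := by
  classical
  let F : Finset (Finset V) := Finset.univ.filter fun T =>
    S ⊆ T ∧ (∀ u ∈ T, ∀ v ∈ T, ¬ G.Adj u v) ∧ ∀ u ∈ T, W u
  have hF : F.Nonempty := ⟨S, by simp [F]; exact ⟨hS, hW⟩⟩
  obtain ⟨T, hT, hmax⟩ := F.exists_max_image Finset.card hF
  simp only [F, Finset.mem_filter, Finset.mem_univ, true_and] at hT hmax
  obtain ⟨h1, h2, h3⟩ := hT
  refine ⟨T, h1, h2, h3, fun v hv hvT => ?_⟩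
  by_contra! hcon
  have := hmax (insert v T) ⟨h1.trans (Finset.subset_insert _ _), ?_, ?_⟩
  · rw [Finset.card_insert_of_notMem hvT] at this; omega
  · exact indep_insert h2 hcon
  · intro u hu
    rcases Finset.mem_insert.1 hu with rfl | hu
    · exact hv
    · exact h3 _ hu

theorem indepOn_card_le [Fintype V] (G : SimpleGraph V) (W : Set V) (S : Finset V)
    (h : IsIndepOn G W ↑S) : S.card ≤ indepNumOn G W := by
  refine le_csSup ⟨Fintype.card V, ?_⟩ ⟨S, h, rfl⟩
  rintro _ ⟨T, -, rfl⟩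
  exact T.card_le_univ

theorem isLocW2_of_W2 [Fintype V] (G : SimpleGraph V) (h2 : W2 G)
    (hloc : LocallyTriangleFree G) : IsLocW2 G (indepNum G) := by
  classical
  obtain ⟨-, hwc, hdel⟩ := h2
  have hle : ∀ S : Finset V, (∀ u ∈ S, ∀ v ∈ S, ¬ G.Adj u v) → S.card ≤ indepNum G :=
    fun S hS => indepOn_card_le G _ S ⟨Set.subset_univ _, fun u hu v hv => hS u hu v hv⟩
  have hmax : ∀ (W : Set V) (T : Finset V), (∀ u ∈ T, ∀ v ∈ T, ¬ G.Adj u v) →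
      (∀ u ∈ T, u ∈ W) → (∀ v, v ∈ W → v ∉ T → ∃ u ∈ T, G.Adj u v) → MaxIndepOn G W T := by
    intro W T h1 h2 h3
    refine ⟨⟨fun u hu => h2 u hu, fun u hu v hv => h1 u hu v hv⟩, fun v hv hvT hcon => ?_⟩
    obtain ⟨u, hu, huv⟩ := h3 v hv hvT
    exact hcon.2 (Set.mem_insert_of_mem _ hu) (Set.mem_insert _ _) huv
  refine ⟨hle, ?_, ?_, ?_⟩
  · intro S hS hlt
    by_contra! hcon
    have := hwc S (hmax _ S hS (fun _ _ => Set.mem_univ _) fun v _ hv => hcon v hv)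
    change S.card < indepNumOn G Set.univ at hlt
    omega
  · intro S v hS hv hfar
    by_contra! hcon
    obtain ⟨T, hST, hT, hTW, hTmax⟩ := exists_maximal_indep G (· ∈ Set.univ \ {v}) S hS
      (fun u hu => ⟨Set.mem_univ _, fun h => hv (h ▸ hu)⟩)
    obtain ⟨hw, heq⟩ := hdel v (Set.mem_univ _)
    have hc := hw T (hmax _ T hT hTW hTmax)
    have hvT : v ∉ T := fun h => (hTW v h).2 rfl
    have hfarT : ∀ u ∈ T, ¬ G.Adj v u := by
      intro u hu
      by_cases huS : u ∈ S
      · exact fun h => hfar u huS h.symm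
      · exact hcon u huS fun w hw => hT w (hST hw) u hu
    have := hle (insert v T) ?_
    · rw [Finset.card_insert_of_notMem hvT, hc, heq] at this
      change _ ≤ indepNumOn G Set.univ at this
      omega
    · exact indep_insert hT fun u hu h => hfarT u hu h.symm
  · intro p q r hpq hqr hpr v
    by_contra! hcon
    obtain ⟨hp, hq, hr⟩ := hcon
    have key : ∀ u, ¬ G.Adj v u → u ≠ v → u ∈ GDel G {v} := by
      intro u h1 h2
      simp [GDel, nbhd, h1, h2]
    exact hloc v p (key p hp (by rintro rfl; exact hq hpq)) q
      (key q hq (by rintro rfl; exact hp hpq.symm)) r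
      (key r hr (by rintro rfl; exact hp hpr.symm)) ⟨hpq, hqr, hpr⟩

namespace IsLocW2

variable {G : SimpleGraph V} {n : ℕ}

theorem card_lt (hG : IsLocW2 G n) {S : Finset V} {v : V}
    (hS : ∀ u ∈ S, ∀ w ∈ S, ¬ G.Adj u w) (hv : v ∉ S) (hfar : ∀ u ∈ S, ¬ G.Adj u v) :
    S.card < n := by
  classical
  have := hG.card_le (insert v S) (indep_insert hS hfar)
  rwa [Finset.card_insert_of_notMem hv] at this

/-- For an edge `ab`, every nonempty maximal independent set of `G_{ab}` has `α(G) - 1`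
elements. -/
theorem card_add_one_of_maximal (hG : IsLocW2 G n) {a b : V} (hab : G.Adj a b) {S : Finset V}
    (hne : S.Nonempty) (hS : ∀ u ∈ S, ∀ v ∈ S, ¬ G.Adj u v)
    (hSab : ∀ u ∈ S, ¬ G.Adj a u ∧ ¬ G.Adj b u)
    (hmax : ∀ v, ¬ G.Adj a v → ¬ G.Adj b v → v ∉ S → ∃ u ∈ S, G.Adj u v) :
    S.card + 1 = n := by
  classical
  have haS : a ∉ S := fun h => (hSab a h).2 hab.symm
  have hlt := hG.card_lt hS haS fun u hu h => (hSab u hu).1 h.symm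
  by_contra hne'
  have hI : ∀ u ∈ insert a S, ∀ w ∈ insert a S, ¬ G.Adj u w :=
    indep_insert hS fun u hu h => (hSab u hu).1 h.symm
  have hcard : (insert a S).card < n := by
    rw [Finset.card_insert_of_notMem haS]; omega
  obtain ⟨u, hu, hufar⟩ := hG.exists_far _ hI hcard
  obtain ⟨w, hw, hwfar, huw⟩ := hG.exists_adj _ u hI hu hufar
  simp only [Finset.mem_insert, not_or, forall_eq_or_imp] at hu hufar hw hwfar
  have hb : ∀ v, v ∉ S → ¬ G.Adj a v → (∀ s ∈ S, ¬ G.Adj s v) → G.Adj b v := by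
    intro v hv hav hfar
    by_contra hbv
    obtain ⟨s, hs, hsv⟩ := hmax v hav hbv hv
    exact hfar s hs hsv
  obtain ⟨s, hs⟩ := hne
  rcases hG.dom b u w (hb u hu.2 hufar.1 hufar.2) huw (hb w hw.2 hwfar.1 hwfar.2) s with h | h | h
  · exact (hSab s hs).2 h.symm
  · exact hufar.2 s hs h
  · exact hwfar.2 s hs h

theorem exists_adj₁ (hG : IsLocW2 G n) {p v : V} (hv : v ≠ p) (hpv : ¬ G.Adj p v) :
    ∃ w, w ≠ p ∧ ¬ G.Adj p w ∧ G.Adj v w := by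
  simpa using hG.exists_adj {p} v (by simp) (by simpa using hv) (by simpa using hpv)

open Classical in
theorem exists_adj₂ (hG : IsLocW2 G n) {p q v : V} (hpq : ¬ G.Adj p q)
    (hvp : v ≠ p) (hvq : v ≠ q) (hpv : ¬ G.Adj p v) (hqv : ¬ G.Adj q v) :
    ∃ w, w ≠ p ∧ w ≠ q ∧ ¬ G.Adj p w ∧ ¬ G.Adj q w ∧ G.Adj v w := by
  obtain ⟨w, hw, hfar, h⟩ := hG.exists_adj {p, q} v (by grind [G.adj_comm, G.irrefl])
    (by grind) (by grind)
  exact ⟨w, by grind⟩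

open Classical in
theorem exists_adj₃ (hG : IsLocW2 G n) {p q r v : V} (hpq : ¬ G.Adj p q) (hpr : ¬ G.Adj p r)
    (hqr : ¬ G.Adj q r) (hvp : v ≠ p) (hvq : v ≠ q) (hvr : v ≠ r)
    (hpv : ¬ G.Adj p v) (hqv : ¬ G.Adj q v) (hrv : ¬ G.Adj r v) :
    ∃ w, w ≠ p ∧ w ≠ q ∧ w ≠ r ∧ ¬ G.Adj p w ∧ ¬ G.Adj q w ∧ ¬ G.Adj r w ∧ G.Adj v w := by
  obtain ⟨w, hw, hfar, h⟩ := hG.exists_adj {p, q, r} v (by grind [G.adj_comm, G.irrefl])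
    (by grind) (by grind)
  exact ⟨w, by grind⟩

open Classical in
theorem exists_adj₄ (hG : IsLocW2 G n) {p q r s v : V} (hpq : ¬ G.Adj p q) (hpr : ¬ G.Adj p r)
    (hps : ¬ G.Adj p s) (hqr : ¬ G.Adj q r) (hqs : ¬ G.Adj q s) (hrs : ¬ G.Adj r s)
    (hvp : v ≠ p) (hvq : v ≠ q) (hvr : v ≠ r) (hvs : v ≠ s)
    (hpv : ¬ G.Adj p v) (hqv : ¬ G.Adj q v) (hrv : ¬ G.Adj r v) (hsv : ¬ G.Adj s v) :
    ∃ w, w ≠ p ∧ w ≠ q ∧ w ≠ r ∧ w ≠ s ∧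
      ¬ G.Adj p w ∧ ¬ G.Adj q w ∧ ¬ G.Adj r w ∧ ¬ G.Adj s w ∧ G.Adj v w := by
  obtain ⟨w, hw, hfar, h⟩ := hG.exists_adj {p, q, r, s} v (by grind [G.adj_comm, G.irrefl])
    (by grind) (by grind)
  exact ⟨w, by grind⟩

theorem adj_iff_not_adj (hG : IsLocW2 G n) {a b x y d : V} (hxy : G.Adj x y) (hax : G.Adj a x)
    (hay : G.Adj a y) (hbx : ¬ G.Adj b x) (hby : ¬ G.Adj b y) (had : ¬ G.Adj a d)
    (hbd : ¬ G.Adj b d) : G.Adj x d ↔ ¬ G.Adj y d := by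
  refine ⟨fun h1 h2 => ?_, fun h => ?_⟩
  · rcases hG.dom x y d hxy h2 h1 b with h | h | h
    exacts [hbx h, hby h, hbd h]
  · rcases hG.dom a x y hax hxy hay d with h' | h' | h'
    exacts [(had h'.symm).elim, h'.symm, (h h'.symm).elim]

open Classical in
/-- The structure of `D = G_{ab}` and of `N_G(a) \ N_G[b]` around an edge `xy` of the latter. -/
theorem edge_structure [Fintype V] (hG : IsLocW2 G n) {a b x y d₀ : V} (hab : G.Adj a b)
    (hxy : G.Adj x y) (hax : G.Adj a x) (hay : G.Adj a y) (hbx : ¬ G.Adj b x)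
    (hby : ¬ G.Adj b y) (had₀ : ¬ G.Adj a d₀) (hbd₀ : ¬ G.Adj b d₀) :
    (Finset.univ.filter fun d => ¬ G.Adj a d ∧ ¬ G.Adj b d ∧ G.Adj x d).card + 2 = n ∧
    (∃ d', ¬ G.Adj a d' ∧ ¬ G.Adj b d' ∧ G.Adj y d' ∧
      (∀ d, ¬ G.Adj a d → ¬ G.Adj b d → ¬ G.Adj d' d) ∧
      ∀ d, ¬ G.Adj a d → ¬ G.Adj b d → G.Adj y d → d ≠ d' →
        ∃ e, ¬ G.Adj a e ∧ ¬ G.Adj b e ∧ G.Adj x e ∧ G.Adj d e) ∧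
    ∀ v, G.Adj a v → ¬ G.Adj b v → v ≠ b → G.Adj x v → v = y := by
  have hP : ∀ d, ¬ G.Adj a d → ¬ G.Adj b d → (G.Adj x d ↔ ¬ G.Adj y d) :=
    fun d => hG.adj_iff_not_adj hxy hax hay hbx hby
  have hxb : x ≠ b := by rintro rfl; exact hby hxy
  have hyb : y ≠ b := by rintro rfl; exact hbx hxy.symm
  have htri : ∀ p q r, ¬ G.Adj b p → ¬ G.Adj b q → ¬ G.Adj b r → G.Adj p q → G.Adj p r →
      ¬ G.Adj q r := by
    intro p q r hp hq hr h1 h2 h3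
    rcases hG.dom p q r h1 h3 h2 b with h | h | h
    exacts [hp h, hq h, hr h]
  set X := Finset.univ.filter fun d => ¬ G.Adj a d ∧ ¬ G.Adj b d ∧ G.Adj x d with hX
  have hmX : ∀ d, d ∈ X ↔ ¬ G.Adj a d ∧ ¬ G.Adj b d ∧ G.Adj x d := by simp [hX]
  have hXI : ∀ u ∈ X, ∀ v ∈ X, ¬ G.Adj u v := by
    intro u hu v hv
    rw [hmX] at hu hv
    exact htri x u v hbx hu.2.1 hv.2.1 hu.2.2 hv.2.2
  obtain ⟨S, hXS, hSI, hSD, hSmax⟩ := exists_maximal_indep G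
    (fun d => ¬ G.Adj a d ∧ ¬ G.Adj b d) X hXI (fun u hu => by rw [hmX] at hu; tauto)
  have hSne : S.Nonempty := by
    by_cases h : d₀ ∈ S
    · exact ⟨_, h⟩
    · obtain ⟨u, hu, -⟩ := hSmax d₀ ⟨had₀, hbd₀⟩ h
      exact ⟨u, hu⟩
  have hScard := hG.card_add_one_of_maximal hab hSne hSI hSD
    fun v h1 h2 => hSmax v ⟨h1, h2⟩
  have hbS : b ∉ S := fun h => (hSD b h).1 hab
  have hbI := indep_insert hSI fun u hu h => (hSD u hu).2 h.symm
  have hnot : ∀ z, G.Adj a z → ¬ G.Adj b z → z ≠ b → ∃ d ∈ S, G.Adj z d := by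
    intro z haz hbz hzb
    by_contra! hcon
    have hz : z ∉ insert b S := by
      simp only [Finset.mem_insert, not_or]
      exact ⟨hzb, fun h => (hSD z h).1 haz⟩
    have := hG.card_lt hbI hz (by grind [G.adj_comm])
    rw [Finset.card_insert_of_notMem hbS] at this
    omega
  obtain ⟨d₁, hd₁S, hyd₁⟩ := hnot y hay hby hyb
  obtain ⟨d₂, hd₂S, hxd₂⟩ := hnot x hax hbx hxb
  have hd₁X : d₁ ∉ X := by
    rw [hmX]
    have := hSD d₁ hd₁S
    have := hP d₁ this.1 this.2
    tauto
  have hd₂X : d₂ ∈ X := (hmX _).2 ⟨(hSD _ hd₂S).1, (hSD _ hd₂S).2, hxd₂⟩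
  have hyX : ∀ u ∈ X, ¬ G.Adj u y := by
    intro u hu h
    rw [hmX] at hu
    exact (hP u hu.1 hu.2.1).1 hu.2.2 h.symm
  have hyXI := indep_insert hXI hyX
  have hb' : ∀ u ∈ insert y X, ¬ G.Adj u b := by grind [G.adj_comm]
  have hbyXI := indep_insert hyXI hb'
  have hyX' : y ∉ X := fun h => ((hmX y).1 h).1 hay
  have hbX' : b ∉ insert y X := by grind [G.adj_comm]
  have hcardXy : (insert b (insert y X)).card = X.card + 2 := by
    rw [Finset.card_insert_of_notMem hbX', Finset.card_insert_of_notMem hyX']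
  have hsub : insert d₁ X ⊆ S := by
    intro u hu
    rcases Finset.mem_insert.1 hu with rfl | hu
    exacts [hd₁S, hXS hu]
  have hsubcard := Finset.card_le_card hsub
  rw [Finset.card_insert_of_notMem hd₁X] at hsubcard
  have hfarA : ∀ z, z ∉ insert b (insert y X) → (∀ u ∈ insert b (insert y X), ¬ G.Adj u z) →
      G.Adj a z := by
    intro z hz hfar
    by_contra haz
    have hbz := hfar b (by simp)
    have hyz := hfar y (by simp)
    exact hz (by
      simp only [Finset.mem_insert]
      exact Or.inr (Or.inr ((hmX z).2 ⟨haz, hbz, (hP z haz hbz).2 hyz⟩)))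
  have hXcard : X.card + 2 = n := by
    by_contra hne
    obtain ⟨z, hz, hzfar⟩ := hG.exists_far _ hbyXI (by omega)
    obtain ⟨w, hw, hwfar, hzw⟩ := hG.exists_adj _ z hbyXI hz hzfar
    have hXmem : d₂ ∈ insert b (insert y X) := by simp [hd₂X]
    rcases hG.dom a z w (hfarA z hz hzfar) hzw (hfarA w hw hwfar) d₂ with h | h | h
    · exact (hSD d₂ hd₂S).1 h.symm
    · exact hzfar _ hXmem h
    · exact hwfar _ hXmem h
  have hSeq : insert d₁ X = S := by
    refine Finset.eq_of_subset_of_card_le hsub ?_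
    rw [Finset.card_insert_of_notMem hd₁X]
    omega
  have hd₁ab := hSD d₁ hd₁S
  refine ⟨hXcard, ⟨d₁, hd₁ab.1, hd₁ab.2, hyd₁, ?_, ?_⟩, ?_⟩
  · intro d had hbd
    by_cases hyd : G.Adj y d
    · exact htri y d₁ d hby hd₁ab.2 hbd hyd₁ hyd
    · exact hSI d₁ hd₁S d (hXS ((hmX d).2 ⟨had, hbd, (hP d had hbd).2 hyd⟩))
  · intro d had hbd hyd hne
    have hdX : d ∉ X := fun h => (hP d had hbd).1 ((hmX d).1 h).2.2 hyd
    have hdS : d ∉ S := by rw [← hSeq]; simp [hne, hdX]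
    obtain ⟨e, he, hed⟩ := hSmax d ⟨had, hbd⟩ hdS
    rw [← hSeq] at he
    rcases Finset.mem_insert.1 he with rfl | he
    · exact (htri y e d hby hd₁ab.2 hbd hyd₁ hyd hed).elim
    · rw [hmX] at he
      exact ⟨e, he.1, he.2.1, he.2.2, hed.symm⟩
  · intro v hav hbv hvb hxv
    by_contra hvy
    have := hG.card_lt (v := v) hbyXI ?_ ?_
    · omega
    · simp only [Finset.mem_insert, not_or]
      exact ⟨hvb, hvy, fun h => ((hmX v).1 h).1 hav⟩
    · simp only [Finset.mem_insert, forall_eq_or_imp]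
      refine ⟨hbv, htri x y v hbx hby hbv hxy hxv, fun u hu => ?_⟩
      rw [hmX] at hu
      exact htri x u v hbx hu.2.1 hbv hu.2.2 hxv

open Classical in
/-- If `G_{ab}` is empty and a vertex `u` of `N_G(a) \ N_G[b]` is not adjacent to some vertex of
`N_G(b) \ N_G[a]`, then `u` is adjacent to all common neighbours of `a` and `b`. -/
theorem adj_common_of_not_adj [Fintype V] (hG : IsLocW2 G n) {a b u β c : V}
    (hD : ∀ v, G.Adj a v ∨ G.Adj b v) (hau : G.Adj a u) (hbu : ¬ G.Adj b u)
    (haβ : ¬ G.Adj a β) (huβ : ¬ G.Adj u β) (hac : G.Adj a c)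
    (hbc : G.Adj b c) : G.Adj u c := by
  by_contra huc
  have htri : ∀ v w, G.Adj b v → G.Adj b w → ¬ G.Adj u v → ¬ G.Adj u w → ¬ G.Adj v w := by
    intro v w h1 h2 h3 h4 h5
    rcases hG.dom b v w h1 h5 h2 u with h | h | h
    exacts [hbu h.symm, h3 h, h4 h]
  have hb : ∀ v, ¬ G.Adj a v → G.Adj b v := fun v h => (hD v).resolve_left h
  set T := Finset.univ.filter fun v => ¬ G.Adj a v ∧ ¬ G.Adj u v with hT
  have hmT : ∀ v, v ∈ T ↔ ¬ G.Adj a v ∧ ¬ G.Adj u v := by simp [hT]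
  have hTI : ∀ v ∈ T, ∀ w ∈ T, ¬ G.Adj v w := by
    intro v hv w hw
    rw [hmT] at hv hw
    exact htri v w (hb v hv.1) (hb w hw.1) hv.2 hw.2
  have hcard := hG.card_add_one_of_maximal hau ⟨β, (hmT β).2 ⟨haβ, huβ⟩⟩ hTI
    (fun v hv => (hmT v).1 hv) fun v h1 h2 h3 => (h3 ((hmT v).2 ⟨h1, h2⟩)).elim
  have huT : u ∉ T := fun h => ((hmT u).1 h).1 hau
  have huTI := indep_insert hTI fun v hv h => ((hmT v).1 hv).2 h.symm
  have := hG.card_lt (v := c) huTI ?_ ?_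
  · rw [Finset.card_insert_of_notMem huT] at this
    omega
  · simp only [Finset.mem_insert, not_or]
    exact ⟨fun h => hbu (h ▸ hbc), fun h => ((hmT c).1 h).1 hac⟩
  · simp only [Finset.mem_insert, forall_eq_or_imp]
    refine ⟨huc, fun v hv => ?_⟩
    rw [hmT] at hv
    exact htri v c (hb v hv.1) hbc hv.2 huc

open Classical in
theorem forall_adj_common [Fintype V] (hG : IsLocW2 G n) (hn : 3 ≤ n) {a b x β : V}
    (hab : G.Adj a b) (hD : ∀ v, G.Adj a v ∨ G.Adj b v) (hax : G.Adj a x) (hbx : ¬ G.Adj b x)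
    (hxb : x ≠ b) (haβ : ¬ G.Adj a β) (hβa : β ≠ a) (hxβ : ¬ G.Adj x β)
    {u c : V} (hau : G.Adj a u) (hbu : ¬ G.Adj b u) (hub : u ≠ b)
    (hac : G.Adj a c) (hbc : G.Adj b c) : G.Adj u c := by
  have hspread : ∀ v z, G.Adj a v → ¬ G.Adj b v → v ≠ b → G.Adj a z → ¬ G.Adj b z → z ≠ b →
      (∃ β, ¬ G.Adj a β ∧ β ≠ a ∧ ¬ G.Adj v β) → ¬ G.Adj v z →
      ∃ β, ¬ G.Adj a β ∧ β ≠ a ∧ ¬ G.Adj z β := by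
    rintro v z hav hbv hvb haz hbz hzb ⟨β, h1, h2, h3⟩ hvz
    by_contra! hcon
    obtain ⟨w, hwv, hwz, hvw, hzw, hbw⟩ := hG.exists_adj₂ (p := v) (q := z) (v := b) hvz hvb.symm
      hzb.symm (fun h => hbv h.symm) (fun h => hbz h.symm)
    by_cases haw : G.Adj a w
    · exact hvw (hG.adj_common_of_not_adj hD hav hbv h1 h3 haw hbw)
    · exact hzw (hcon w haw (by rintro rfl; exact hvw hav.symm))
  by_cases hu : ∃ β, ¬ G.Adj a β ∧ β ≠ a ∧ ¬ G.Adj u β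
  · obtain ⟨β', h1, -, h3⟩ := hu
    exact hG.adj_common_of_not_adj hD hau hbu h1 h3 hac hbc
  exfalso
  have hux : ∀ z, G.Adj a z → ¬ G.Adj b z → z ≠ b →
      (∃ β, ¬ G.Adj a β ∧ β ≠ a ∧ ¬ G.Adj z β) → G.Adj u z := by
    intro z h1 h2 h3 h4
    by_contra h5
    exact hu (hspread z u h1 h2 h3 hau hbu hub h4 fun h => h5 h.symm)
  have hx : ∃ β, ¬ G.Adj a β ∧ β ≠ a ∧ ¬ G.Adj x β := ⟨β, haβ, hβa, hxβ⟩
  obtain ⟨z, hz, hzfar⟩ := hG.exists_far {b, x} (by grind [G.adj_comm, G.irrefl]) (by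
    rw [Finset.card_pair hxb.symm]; omega)
  simp only [Finset.mem_insert, Finset.mem_singleton, not_or, forall_eq_or_imp, forall_eq]
    at hz hzfar
  have ha : ∀ v, ¬ G.Adj b v → G.Adj a v := fun v h => (hD v).resolve_right h
  have hz1 := hspread x z hax hbx hxb (ha z hzfar.1) hzfar.1 hz.1 hx hzfar.2
  obtain ⟨w, hwb, hwx, hbw, hxw, hzw⟩ := hG.exists_adj₂ hbx hz.1 hz.2 hzfar.1 hzfar.2
  have hw1 := hspread x w hax hbx hxb (ha w hbw) hbw hwb hx hxw
  rcases hG.dom u z w (hux z (ha z hzfar.1) hzfar.1 hz.1 hz1) hzw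
    (hux w (ha w hbw) hbw hwb hw1) b with h | h | h
  exacts [hbu h, hzfar.1 h, hbw h]

theorem isJoin_of_not_adj [Fintype V] (hG : IsLocW2 G n) (hn : 3 ≤ n) {a b c x β : V}
    (hab : G.Adj a b) (hac : G.Adj a c) (hbc : G.Adj b c) (hD : ∀ v, G.Adj a v ∨ G.Adj b v)
    (hbx : ¬ G.Adj b x) (hxb : x ≠ b) (haβ : ¬ G.Adj a β) (hβa : β ≠ a) (hxβ : ¬ G.Adj x β) :
    IsJoin G := by
  have hax := (hD x).resolve_right hbx
  have hbβ := (hD β).resolve_left haβ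
  refine ⟨{v | G.Adj a v ∧ G.Adj b v}, {v | G.Adj a v ∧ G.Adj b v}ᶜ, ⟨c, hac, hbc⟩,
    ⟨a, fun h => G.irrefl h.1⟩, disjoint_compl_right, Set.union_compl_self _, ?_⟩
  rintro p ⟨hap, hbp⟩ q hq
  simp only [Set.mem_compl_iff, Set.mem_ofPred_eq, not_and_or] at hq
  by_cases hqa : q = a
  · exact hqa ▸ hap.symm
  by_cases hqb : q = b
  · exact hqb ▸ hbp.symm
  rcases hq with hq | hq
  · exact (hG.forall_adj_common hn hab.symm (fun v => (hD v).symm) hbβ haβ hβa hbx hxb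
      (fun h => hxβ h.symm) ((hD q).resolve_left hq) hq hqa hbp hap).symm
  · exact (hG.forall_adj_common hn hab hD hax hbx hxb haβ hβa hxβ
      ((hD q).resolve_right hq) hq hqb hap hbp).symm

theorem isJoin_of_forall_adj [Fintype V] (hG : IsLocW2 G n) (hn : 3 ≤ n) {a b c : V}
    (hab : G.Adj a b) (hac : G.Adj a c) (hbc : G.Adj b c) (hD : ∀ v, G.Adj a v ∨ G.Adj b v) :
    IsJoin G := by
  by_cases hA : ∃ x β, ¬ G.Adj b x ∧ x ≠ b ∧ ¬ G.Adj a β ∧ β ≠ a ∧ ¬ G.Adj x β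
  · obtain ⟨x, β, h1, h2, h3, h4, h5⟩ := hA
    exact hG.isJoin_of_not_adj hn hab hac hbc hD h1 h2 h3 h4 h5
  push Not at hA
  by_contra hjoin
  have hxA : ∃ x, ¬ G.Adj b x ∧ x ≠ b := by
    obtain ⟨x, hx, hfar⟩ := hG.exists_far {b} (by simp) (by simp; omega)
    exact ⟨x, by simpa using hfar, by simpa using hx⟩
  let P : V → Prop := fun v => ∀ u, ¬ G.Adj b u → u ≠ b → G.Adj u v
  have hPa : P a := fun u h1 h2 => ((hD u).resolve_right h1).symm
  have hPB : ∀ v, ¬ G.Adj a v → v ≠ a → P v := fun v h1 h2 u h3 h4 => hA u v h3 h4 h1 h2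
  have hPb : ∀ v, P v → G.Adj b v := by
    intro v hv
    by_contra hbv
    by_cases hvb : v = b
    · obtain ⟨x, hbx, hxb⟩ := hxA
      exact hbx (hvb ▸ (hv x hbx hxb).symm)
    · exact G.irrefl (hv v hbv hvb)
  refine hjoin ⟨{v | P v}, {v | P v}ᶜ, ⟨a, hPa⟩, ⟨b, fun h => G.irrefl (hPb b h)⟩,
    disjoint_compl_right, Set.union_compl_self _, ?_⟩
  intro q hq p hp
  change P q at hq
  change ¬ P p at hp
  have hbq := hPb q hq
  by_contra hqp
  by_cases hpb : p = b
  · exact hqp (hpb ▸ hbq.symm)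
  by_cases hbp : G.Adj b p
  swap
  · exact hqp (hq p hbp hpb).symm
  have hpq : p ≠ q := by rintro rfl; exact hp hq
  obtain ⟨x, hbx, hxb, hxp⟩ : ∃ x, ¬ G.Adj b x ∧ x ≠ b ∧ ¬ G.Adj x p := by
    simpa [P] using hp
  obtain ⟨c', hqc, hbc'⟩ : ∃ c', G.Adj q c' ∧ G.Adj b c' := by
    by_cases haq : G.Adj a q
    · exact ⟨a, haq.symm, hab.symm⟩
    · have hqa : q ≠ a := by
        rintro rfl
        by_cases hap : G.Adj q p
        · exact hqp hap
        · exact hp (hPB p hap hpq)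
      obtain ⟨w, hwa, haw, hqw⟩ := hG.exists_adj₁ hqa haq
      exact ⟨w, hqw, (hD w).resolve_left haw⟩
  refine hjoin (hG.isJoin_of_not_adj hn hbq.symm hqc hbc' (fun v => ?_) hbx hxb hqp hpq hxp)
  by_cases hvb : v = b
  · exact Or.inl (hvb ▸ hbq.symm)
  by_cases hbv : G.Adj b v
  · exact Or.inr hbv
  · exact Or.inl (hq v hbv hvb).symm

open Classical in
theorem exists_edge_of_edge [Fintype V] (hG : IsLocW2 G n) (hn : 4 ≤ n) {a b x y d₀ : V}
    (hab : G.Adj a b) (hxy : G.Adj x y) (hax : G.Adj a x) (hay : G.Adj a y) (hbx : ¬ G.Adj b x)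
    (hby : ¬ G.Adj b y) (had₀ : ¬ G.Adj a d₀) (hbd₀ : ¬ G.Adj b d₀) :
    ∃ e e', G.Adj e e' ∧ ¬ G.Adj a e ∧ ¬ G.Adj b e ∧ ¬ G.Adj a e' ∧ ¬ G.Adj b e' := by
  obtain ⟨hcard, -, -⟩ := hG.edge_structure hab hxy hax hay hbx hby had₀ hbd₀
  obtain ⟨-, ⟨d', -, -, -, -, hd'⟩, -⟩ := hG.edge_structure hab hxy.symm hay hax hby hbx had₀ hbd₀
  obtain ⟨e, he, hne⟩ := Finset.exists_mem_ne
    (show 1 < (Finset.univ.filter fun d => ¬ G.Adj a d ∧ ¬ G.Adj b d ∧ G.Adj x d).card by omega) d'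
  simp only [Finset.mem_filter, Finset.mem_univ, true_and] at he
  obtain ⟨e', h1, h2, -, h3⟩ := hd' e he.1 he.2.1 he.2.2 hne
  exact ⟨e, e', h3, he.1, he.2.1, h1, h2⟩

theorem exists_not_adj_of_not_isJoin [Fintype V] (hG : IsLocW2 G n) (hn : 3 ≤ n)
    (hjoin : ¬ IsJoin G) {a b c : V}
    (hab : G.Adj a b) (hac : G.Adj a c) (hbc : G.Adj b c) : ∃ v, ¬ G.Adj a v ∧ ¬ G.Adj b v := by
  by_contra! hcon
  exact hjoin (hG.isJoin_of_forall_adj hn hab hac hbc fun v => or_iff_not_imp_left.2 (hcon v))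

theorem adj_of_not_adj (hG : IsLocW2 G n) {a b c : V} (hab : G.Adj a b) (hbc : G.Adj b c)
    (hac : G.Adj a c) {v : V} (hb : ¬ G.Adj b v) (hc : ¬ G.Adj c v) : G.Adj a v := by
  rcases hG.dom a b c hab hbc hac v with h | h | h
  exacts [h.symm, (hb h.symm).elim, (hc h.symm).elim]

theorem not_adj_of_edge [Fintype V] (hG : IsLocW2 G n) (hn : 3 ≤ n) (hjoin : ¬ IsJoin G)
    {a b c e e' : V} (hab : G.Adj a b) (hbc : G.Adj b c) (hac : G.Adj a c) (hee' : G.Adj e e')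
    (hae : ¬ G.Adj a e) (hbe : ¬ G.Adj b e) (hae' : ¬ G.Adj a e') (hbe' : ¬ G.Adj b e')
    {v : V} (hav : G.Adj a v) (hbv : ¬ G.Adj b v) (hvb : v ≠ b) : ¬ G.Adj c v := by
  intro hcv
  have hce := hG.adj_of_not_adj hac.symm hab hbc.symm hae hbe
  have hce' := hG.adj_of_not_adj hac.symm hab hbc.symm hae' hbe'
  have key : ∀ d d', G.Adj d d' → G.Adj c d → G.Adj c d' → ¬ G.Adj a d → ¬ G.Adj b d →
      G.Adj d v := by
    intro d d' hdd' hcd hcd' had hbd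
    by_contra hdv
    obtain ⟨d₀, h1, h2⟩ := hG.exists_not_adj_of_not_isJoin hn hjoin hcd hcd' hdd'
    obtain ⟨-, -, h⟩ := hG.edge_structure hcd hab hac.symm hbc.symm (fun h => had h.symm)
      (fun h => hbd h.symm) h1 h2
    exact hvb (h v hcv hdv (by rintro rfl; exact had hav) hav)
  rcases hG.dom e e' v hee' (key e' e hee'.symm hce' hce hae' hbe')
    (key e e' hee' hce hce' hae hbe) b with h | h | h
  exacts [hbe h, hbe' h, hbv h]

end IsLocW2

/-- A triangle `abc` such that no vertex has exactly one non-neighbour among `a`, `b`, `c` and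
such that each of `G_{ab}`, `G_{bc}`, `G_{ac}` contains an edge. -/
structure IsTri (G : SimpleGraph V) (a b c : V) : Prop where
  hab : G.Adj a b
  hbc : G.Adj b c
  hac : G.Adj a c
  na : ∀ v, ¬ G.Adj a v → v ≠ a → ¬ G.Adj b v ∨ ¬ G.Adj c v
  nb : ∀ v, ¬ G.Adj b v → v ≠ b → ¬ G.Adj a v ∨ ¬ G.Adj c v
  nc : ∀ v, ¬ G.Adj c v → v ≠ c → ¬ G.Adj a v ∨ ¬ G.Adj b v
  edge_bc : ∃ p q, G.Adj p q ∧ ¬ G.Adj b p ∧ ¬ G.Adj c p ∧ ¬ G.Adj b q ∧ ¬ G.Adj c q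
  edge_ac : ∃ p q, G.Adj p q ∧ ¬ G.Adj a p ∧ ¬ G.Adj c p ∧ ¬ G.Adj a q ∧ ¬ G.Adj c q
  edge_ab : ∃ p q, G.Adj p q ∧ ¬ G.Adj a p ∧ ¬ G.Adj b p ∧ ¬ G.Adj a q ∧ ¬ G.Adj b q

namespace IsTri

variable {G : SimpleGraph V} {n : ℕ} {a b c : V}

theorem swap (h : IsTri G a b c) : IsTri G b a c where
  hab := h.hab.symm
  hbc := h.hac
  hac := h.hbc
  na := h.nb
  nb := h.na
  nc v h1 h2 := (h.nc v h1 h2).symm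
  edge_bc := h.edge_ac
  edge_ac := h.edge_bc
  edge_ab := by obtain ⟨p, q, h1, h2, h3, h4, h5⟩ := h.edge_ab; exact ⟨p, q, h1, h3, h2, h5, h4⟩

theorem reverse (h : IsTri G a b c) : IsTri G c b a where
  hab := h.hbc.symm
  hbc := h.hab.symm
  hac := h.hac.symm
  na v h1 h2 := (h.nc v h1 h2).symm
  nb v h1 h2 := (h.nb v h1 h2).symm
  nc v h1 h2 := (h.na v h1 h2).symm
  edge_bc := by obtain ⟨p, q, h1, h2, h3, h4, h5⟩ := h.edge_ab; exact ⟨p, q, h1, h3, h2, h5, h4⟩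
  edge_ac := by obtain ⟨p, q, h1, h2, h3, h4, h5⟩ := h.edge_ac; exact ⟨p, q, h1, h3, h2, h5, h4⟩
  edge_ab := by obtain ⟨p, q, h1, h2, h3, h4, h5⟩ := h.edge_bc; exact ⟨p, q, h1, h3, h2, h5, h4⟩

theorem of_edge [Fintype V] (hG : IsLocW2 G n) (hn : 4 ≤ n) (hjoin : ¬ IsJoin G)
    (hab : G.Adj a b) (hbc : G.Adj b c) (hac : G.Adj a c) {x y : V} (hxy : G.Adj x y)
    (hax : G.Adj a x) (hay : G.Adj a y) (hbx : ¬ G.Adj b x) (hby : ¬ G.Adj b y) :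
    IsTri G a b c := by
  have hn' : 3 ≤ n := by omega
  have hxb : x ≠ b := by rintro rfl; exact hby hxy
  have hyb : y ≠ b := by rintro rfl; exact hbx hxy.symm
  obtain ⟨d₀, h1, h2⟩ := hG.exists_not_adj_of_not_isJoin hn' hjoin hab hac hbc
  obtain ⟨e, e', hee', hae, hbe, hae', hbe'⟩ :=
    hG.exists_edge_of_edge hn hab hxy hax hay hbx hby h1 h2
  have hA : ∀ c v, G.Adj a c → G.Adj b c → G.Adj a v → ¬ G.Adj b v → v ≠ b → ¬ G.Adj c v :=
    fun c v hac hbc => hG.not_adj_of_edge hn' hjoin hab hbc hac hee' hae hbe hae' hbe'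
  have hB : ∀ c v, G.Adj a c → G.Adj b c → G.Adj b v → ¬ G.Adj a v → v ≠ a → ¬ G.Adj c v :=
    fun c v hac hbc => hG.not_adj_of_edge hn' hjoin hab.symm hac hbc hee' hbe hae hbe' hae'
  obtain ⟨v₀, h3, h4⟩ := hG.exists_not_adj_of_not_isJoin hn' hjoin hac.symm hbc.symm hab
  refine ⟨hab, hbc, hac, fun v h1 h2 => ?_, fun v h1 h2 => ?_, fun v h1 h2 => ?_,
    ⟨x, y, hxy, hbx, hA c x hac hbc hax hbx hxb, hby, hA c y hac hbc hay hby hyb⟩, ?_,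
    ⟨e, e', hee', hae, hbe, hae', hbe'⟩⟩
  · exact or_iff_not_imp_left.2 fun h => hB c v hac hbc (not_not.1 h) h1 h2
  · exact or_iff_not_imp_left.2 fun h => hA c v hac hbc (not_not.1 h) h1 h2
  · by_contra! hcon
    obtain ⟨hav, hbv⟩ := hcon
    obtain ⟨w, hwc, hcw, hvw⟩ := hG.exists_adj₁ h2 h1
    have hbw : G.Adj b w := by
      by_contra hbw
      by_cases haw : G.Adj a w
      · exact hA v w hav hbv haw hbw (by rintro rfl; exact hcw hbc.symm) hvw
      · exact hcw (hG.adj_of_not_adj hac.symm hab hbc.symm haw hbw)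
    have haw : G.Adj a w := by
      by_contra haw
      exact hB v w hav hbv hbw haw (by rintro rfl; exact hcw hac.symm) hvw
    rcases hG.dom b v w hbv hvw hbw x with h | h | h
    · exact hbx h.symm
    · exact hA v x hav hbv hax hbx hxb h.symm
    · exact hA w x haw hbw hax hbx hxb h.symm
  · obtain ⟨p, q, h⟩ := hG.exists_edge_of_edge hn hac.symm hee'
      (hG.adj_of_not_adj hac.symm hab hbc.symm hae hbe)
      (hG.adj_of_not_adj hac.symm hab hbc.symm hae' hbe') hae hae' h3 h4
    exact ⟨p, q, by tauto⟩

theorem adj_left (h : IsTri G a b c) (hG : IsLocW2 G n) {v : V} (hb : ¬ G.Adj b v)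
    (hc : ¬ G.Adj c v) : G.Adj a v :=
  hG.adj_of_not_adj h.hab h.hbc h.hac hb hc

/-- An edge of `G_{bc}` splits the vertices of `G_{ab}`. -/
theorem adj_iff (h : IsTri G a b c) (hG : IsLocW2 G n) {x y d : V} (hxy : G.Adj x y)
    (hbx : ¬ G.Adj b x) (hcx : ¬ G.Adj c x) (hby : ¬ G.Adj b y) (hcy : ¬ G.Adj c y)
    (had : ¬ G.Adj a d) (hbd : ¬ G.Adj b d) : G.Adj x d ↔ ¬ G.Adj y d :=
  hG.adj_iff_not_adj hxy (h.adj_left hG hbx hcx) (h.adj_left hG hby hcy) hbx hby had hbd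

open Classical in
theorem card_add_two [Fintype V] (h : IsTri G a b c) (hG : IsLocW2 G n) {x y : V}
    (hxy : G.Adj x y) (hbx : ¬ G.Adj b x) (hcx : ¬ G.Adj c x) (hby : ¬ G.Adj b y)
    (hcy : ¬ G.Adj c y) :
    (Finset.univ.filter fun d => ¬ G.Adj a d ∧ ¬ G.Adj b d ∧ G.Adj x d).card + 2 = n := by
  obtain ⟨d₀, -, -, h1, h2, -, -⟩ := h.edge_ab
  exact (hG.edge_structure h.hab hxy (h.adj_left hG hbx hcx) (h.adj_left hG hby hcy) hbx hby
    h1 h2).1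

theorem eq_of_adj [Fintype V] (h : IsTri G a b c) (hG : IsLocW2 G n) {x y v : V}
    (hxy : G.Adj x y) (hbx : ¬ G.Adj b x) (hcx : ¬ G.Adj c x) (hby : ¬ G.Adj b y)
    (hcy : ¬ G.Adj c y) (hbv : ¬ G.Adj b v) (hcv : ¬ G.Adj c v) (hxv : G.Adj x v) : v = y := by
  classical
  obtain ⟨d₀, -, -, h1, h2, -, -⟩ := h.edge_ab
  exact (hG.edge_structure h.hab hxy (h.adj_left hG hbx hcx) (h.adj_left hG hby hcy) hbx hby
    h1 h2).2.2 v (h.adj_left hG hbv hcv) hbv (by rintro rfl; exact hcv h.hbc.symm) hxv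

/-- On each side of an edge of `G_{bc}` there is exactly one isolated vertex of `G_{ab}`. -/
theorem exists_isolated [Fintype V] (h : IsTri G a b c) (hG : IsLocW2 G n) {x y : V}
    (hxy : G.Adj x y) (hbx : ¬ G.Adj b x) (hcx : ¬ G.Adj c x) (hby : ¬ G.Adj b y)
    (hcy : ¬ G.Adj c y) :
    ∃ d', ¬ G.Adj a d' ∧ ¬ G.Adj b d' ∧ G.Adj y d' ∧
      (∀ d, ¬ G.Adj a d → ¬ G.Adj b d → ¬ G.Adj d' d) ∧
      ∀ d, ¬ G.Adj a d → ¬ G.Adj b d → G.Adj y d → d ≠ d' →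
        ∃ e, ¬ G.Adj a e ∧ ¬ G.Adj b e ∧ G.Adj x e ∧ G.Adj d e := by
  classical
  obtain ⟨d₀, -, -, h1, h2, -, -⟩ := h.edge_ab
  exact (hG.edge_structure h.hab hxy (h.adj_left hG hbx hcx) (h.adj_left hG hby hcy) hbx hby
    h1 h2).2.1

open Classical in
theorem card_add_three [Fintype V] (h : IsTri G a b c) (hG : IsLocW2 G n) {x y u v z : V}
    (hxy : G.Adj x y) (hbx : ¬ G.Adj b x) (hcx : ¬ G.Adj c x) (hby : ¬ G.Adj b y)
    (hcy : ¬ G.Adj c y) (huv : G.Adj u v) (hbu : ¬ G.Adj b u) (hcu : ¬ G.Adj c u)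
    (hbv : ¬ G.Adj b v) (hcv : ¬ G.Adj c v) (hux : u ≠ x) (huy : u ≠ y)
    (hbz : ¬ G.Adj b z) (hcz : ¬ G.Adj c z)
    (hz : ∀ t, ¬ G.Adj b t → ¬ G.Adj c t → ¬ G.Adj z t) :
    (Finset.univ.filter fun d =>
      (¬ G.Adj a d ∧ ¬ G.Adj b d ∧ G.Adj y d) ∧ G.Adj v d).card + 3 = n := by
  set S := Finset.univ.filter fun d =>
    (¬ G.Adj a d ∧ ¬ G.Adj b d ∧ G.Adj y d) ∧ G.Adj v d with hS
  have hmS : ∀ d, d ∈ S ↔ ¬ G.Adj a d ∧ ¬ G.Adj b d ∧ G.Adj y d ∧ G.Adj v d := by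
    simp [hS, and_assoc]
  have hbne : ∀ t, ¬ G.Adj c t → t ≠ b := by rintro t ht rfl; exact ht h.hbc.symm
  have hxu : ¬ G.Adj x u := fun hxu => huy (h.eq_of_adj hG hxy hbx hcx hby hcy hbu hcu hxu)
  have hax := h.adj_left hG hbx hcx
  have hau := h.adj_left hG hbu hcu
  have hSI : ∀ p ∈ S, ∀ q ∈ S, ¬ G.Adj p q := by
    intro p hp q hq hpq
    rw [hmS] at hp hq
    rcases hG.dom y p q hp.2.2.1 hpq hq.2.2.1 b with h | h | h
    exacts [hby h, hp.2.1 h, hq.2.1 h]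
  have hSu : ∀ p ∈ S, ¬ G.Adj p u := fun p hp hpu => by
    rw [hmS] at hp
    exact (h.adj_iff hG huv hbu hcu hbv hcv hp.1 hp.2.1).1 hpu.symm hp.2.2.2
  have hSx : ∀ p ∈ S, ¬ G.Adj p x := fun p hp hpx => by
    rw [hmS] at hp
    exact (h.adj_iff hG hxy hbx hcx hby hcy hp.1 hp.2.1).1 hpx.symm hp.2.2.1
  have hxu' : ∀ p ∈ insert u S, ¬ G.Adj p x := by
    simp only [Finset.mem_insert, forall_eq_or_imp]
    exact ⟨fun h => hxu h.symm, hSx⟩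
  have hb' : ∀ p ∈ insert x (insert u S), ¬ G.Adj p b := by
    simp only [Finset.mem_insert, forall_eq_or_imp]
    exact ⟨fun h => hbx h.symm, fun h => hbu h.symm, fun p hp h => ((hmS p).1 hp).2.1 h.symm⟩
  have hI := indep_insert (indep_insert (indep_insert hSI hSu) hxu') hb'
  have huS : u ∉ S := fun h => ((hmS u).1 h).1 hau
  have hxS : x ∉ insert u S := by
    simp only [Finset.mem_insert, not_or]
    exact ⟨hux.symm, fun h => ((hmS x).1 h).1 hax⟩
  have hbS : b ∉ insert x (insert u S) := by
    simp only [Finset.mem_insert, not_or]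
    exact ⟨(hbne x hcx).symm, (hbne u hcu).symm, fun hb => ((hmS b).1 hb).1 h.hab⟩
  have hcard : (insert b (insert x (insert u S))).card = S.card + 3 := by
    rw [Finset.card_insert_of_notMem hbS, Finset.card_insert_of_notMem hxS,
      Finset.card_insert_of_notMem huS]
  have hle := hG.card_le _ hI
  by_contra hne
  obtain ⟨t, ht, htfar⟩ := hG.exists_far _ hI (by omega)
  simp only [Finset.mem_insert, not_or, forall_eq_or_imp] at ht htfar
  obtain ⟨htb, htx, htu, htS⟩ := ht
  obtain ⟨hbt, hxt, hut, hSt⟩ := htfar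
  have hmem : ∀ s, ¬ G.Adj a s → ¬ G.Adj b s → ¬ G.Adj x s → ¬ G.Adj u s → s ∈ S := by
    intro s has hbs hxs hus
    refine (hmS s).2 ⟨has, hbs, ?_, ?_⟩
    · by_contra hys
      exact hxs ((h.adj_iff hG hxy hbx hcx hby hcy has hbs).2 hys)
    · by_contra hvs
      exact hus ((h.adj_iff hG huv hbu hcu hbv hcv has hbs).2 hvs)
  have hct : ¬ G.Adj c t := by
    rcases h.nb t hbt htb with hat | hct
    · exact (htS (hmem t hat hbt hxt hut)).elim
    · exact hct
  by_cases hiso : ∀ s, ¬ G.Adj b s → ¬ G.Adj c s → ¬ G.Adj t s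
  · obtain ⟨s, hsb, hsx, hsu, hbs, hxs, hus, hts⟩ := hG.exists_adj₃ hbx hbu hxu htb htx htu
      hbt hxt hut
    rcases h.nb s hbs hsb with has | hcs
    · exact hSt s (hmem s has hbs hxs hus) hts.symm
    · exact hiso s hbs hcs hts
  · push Not at hiso
    obtain ⟨t', hbt', hct', htt'⟩ := hiso
    have hxt' : ¬ G.Adj x t' := by
      intro hxt'
      obtain rfl := h.eq_of_adj hG hxy hbx hcx hby hcy hbt' hct' hxt'
      exact htx (h.eq_of_adj hG hxy.symm hby hcy hbx hcx hbt hct htt'.symm)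
    have hut' : ¬ G.Adj u t' := by
      intro hut'
      obtain rfl := h.eq_of_adj hG huv hbu hcu hbv hcv hbt' hct' hut'
      exact htu (h.eq_of_adj hG huv.symm hbv hcv hbu hcu hbt hct htt'.symm)
    have hzadj : ∀ {p q}, ¬ G.Adj b q → ¬ G.Adj c q → G.Adj p q → z ≠ p := by
      rintro p q h1 h2 h3 rfl
      exact hz q h1 h2 h3
    obtain ⟨s, hsb, -, -, -, hbs, hxs, hus, ht's, hzs⟩ := hG.exists_adj₄ hbx hbu hbt' hxu hxt' hut'
      (hbne z hcz) (hzadj hby hcy hxy) (hzadj hbv hcv huv) (hzadj hbt hct htt'.symm)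
      hbz (fun h => hz x hbx hcx h.symm) (fun h => hz u hbu hcu h.symm)
      (fun h => hz t' hbt' hct' h.symm)
    rcases h.nb s hbs hsb with has | hcs
    · exact hSt s (hmem s has hbs hxs hus)
        ((h.adj_iff hG htt' hbt hct hbt' hct' has hbs).2 ht's).symm
    · exact hz s hbs hcs hzs

theorem eq_four [Fintype V] (h : IsTri G a b c) (hG : IsLocW2 G n) (hn : 4 ≤ n) : n = 4 := by
  classical
  obtain ⟨x, y, hxy, hbx, hcx, hby, hcy⟩ := h.edge_bc
  obtain ⟨e, e', hee', hae, hbe, hae', hbe'⟩ := h.edge_ab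
  obtain ⟨z, hcz, hbz, -, hz, hz'⟩ := h.reverse.exists_isolated hG hee' hbe hae hbe' hae'
  have hcard := h.reverse.card_add_two hG hee'.symm hbe' hae' hbe hae
  have hsplit : ∀ d, ¬ G.Adj a d → ¬ G.Adj b d → (G.Adj x d ↔ ¬ G.Adj y d) :=
    fun d => h.adj_iff hG hxy hbx hcx hby hcy
  by_contra hne
  set S := Finset.univ.filter fun d => ¬ G.Adj c d ∧ ¬ G.Adj b d ∧ G.Adj e' d with hS
  obtain ⟨u, hu, huz, hux, huy⟩ : ∃ u ∈ S, u ≠ z ∧ u ≠ x ∧ u ≠ y := by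
    by_contra! hcon
    have hle : ∀ p, p ∈ ({x, y} : Finset V) → S ⊆ {z, p} → False := by
      intro p _ hp
      have := Finset.card_le_card hp
      have := Finset.card_le_two (a := z) (b := p)
      omega
    have hmS : ∀ d, d ∈ S → G.Adj e' d := by simp [hS]
    have hxy' := hsplit e' hae' hbe'
    by_cases hx : G.Adj x e'
    · exact hle x (by simp) fun u hu => by grind [G.adj_comm]
    · exact hle y (by simp) fun u hu => by grind [G.adj_comm]
  simp only [hS, Finset.mem_filter, Finset.mem_univ, true_and] at hu
  obtain ⟨hcu, hbu, he'u⟩ := hu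
  obtain ⟨v, hcv, hbv, -, huv⟩ := hz' u hcu hbu he'u huz
  have hvx : v ≠ x := by
    rintro rfl
    exact huy (h.eq_of_adj hG hxy hbx hcx hby hcy hbu hcu huv.symm)
  have hvy : v ≠ y := by
    rintro rfl
    exact hux (h.eq_of_adj hG hxy.symm hby hcy hbx hcx hbu hcu huv.symm)
  have hz'' : ∀ t, ¬ G.Adj b t → ¬ G.Adj c t → ¬ G.Adj z t := fun t h1 h2 => hz t h2 h1
  have h1 := h.card_add_three hG hxy hbx hcx hby hcy huv hbu hcu hbv hcv hux huy hbz hcz hz''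
  have h2 := h.card_add_three hG hxy hbx hcx hby hcy huv.symm hbv hcv hbu hcu hvx hvy hbz hcz hz''
  have h3 := h.card_add_two hG hxy.symm hby hcy hbx hcx
  have h4 := Finset.card_filter_add_card_filter_not (s := Finset.univ.filter fun d =>
    ¬ G.Adj a d ∧ ¬ G.Adj b d ∧ G.Adj y d) (fun d => G.Adj v d)
  have h5 : (Finset.univ.filter fun d => ¬ G.Adj a d ∧ ¬ G.Adj b d ∧ G.Adj y d).filter
      (fun d => ¬ G.Adj v d) = (Finset.univ.filter fun d =>
        ¬ G.Adj a d ∧ ¬ G.Adj b d ∧ G.Adj y d).filter fun d => G.Adj u d := by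
    refine Finset.filter_congr fun d hd => ?_
    simp only [Finset.mem_filter, Finset.mem_univ, true_and] at hd
    exact (h.adj_iff hG huv hbu hcu hbv hcv hd.1 hd.2.1).symm
  rw [h5, Finset.filter_filter, Finset.filter_filter] at h4
  omega

end IsTri

/-- `G_{bc}` has exactly the vertices `x`, `y`, `z`, `w` and the single edge `xy`. -/
structure IsQuad (G : SimpleGraph V) (b c x y z w : V) : Prop where
  mem : ∀ t, (¬ G.Adj b t ∧ ¬ G.Adj c t) ↔ t = x ∨ t = y ∨ t = z ∨ t = w
  adj : G.Adj x y
  iso₁ : ∀ t, ¬ G.Adj b t → ¬ G.Adj c t → ¬ G.Adj z t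
  iso₂ : ∀ t, ¬ G.Adj b t → ¬ G.Adj c t → ¬ G.Adj w t
  ne : z ≠ w

namespace IsQuad

variable {G : SimpleGraph V} {a b c x y z w e e' d d' : V}

theorem swap_edge (h : IsQuad G b c x y z w) : IsQuad G b c y x z w :=
  ⟨fun t => by rw [h.mem]; tauto, h.adj.symm, h.iso₁, h.iso₂, h.ne⟩

theorem swap_iso (h : IsQuad G b c x y z w) : IsQuad G b c x y w z :=
  ⟨fun t => by rw [h.mem]; tauto, h.adj, h.iso₂, h.iso₁, h.ne.symm⟩

theorem symm (h : IsQuad G b c x y z w) : IsQuad G c b x y z w :=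
  ⟨fun t => by rw [and_comm, h.mem], h.adj, fun t h1 h2 => h.iso₁ t h2 h1,
    fun t h1 h2 => h.iso₂ t h2 h1, h.ne⟩

theorem mem₁ (h : IsQuad G b c x y z w) : ¬ G.Adj b x ∧ ¬ G.Adj c x := (h.mem x).2 (by simp)

theorem mem₂ (h : IsQuad G b c x y z w) : ¬ G.Adj b y ∧ ¬ G.Adj c y := (h.mem y).2 (by simp)

theorem mem₃ (h : IsQuad G b c x y z w) : ¬ G.Adj b z ∧ ¬ G.Adj c z := (h.mem z).2 (by simp)

theorem mem₄ (h : IsQuad G b c x y z w) : ¬ G.Adj b w ∧ ¬ G.Adj c w := (h.mem w).2 (by simp)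

theorem exists_of_isTri [Fintype V] (h : IsTri G a b c) (hG : IsLocW2 G 4) :
    ∃ x y z w, IsQuad G b c x y z w := by
  classical
  obtain ⟨e, e', hee', hae, hbe, hae', hbe'⟩ := h.edge_ab
  obtain ⟨z, hcz, hbz, he'z, hz, -⟩ := h.reverse.exists_isolated hG hee' hbe hae hbe' hae'
  obtain ⟨w, hcw, hbw, hew, hw, -⟩ := h.reverse.exists_isolated hG hee'.symm hbe' hae' hbe hae
  have hcard := h.reverse.card_add_two hG hee' hbe hae hbe' hae'
  have hcard' := h.reverse.card_add_two hG hee'.symm hbe' hae' hbe hae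
  have hsplit : ∀ d, ¬ G.Adj c d → ¬ G.Adj b d → (G.Adj e d ↔ ¬ G.Adj e' d) :=
    fun d => h.reverse.adj_iff hG hee' hbe hae hbe' hae'
  obtain ⟨x, y, hxy, hex, hbx, hcx, hby, hcy⟩ : ∃ x y, G.Adj x y ∧ G.Adj e x ∧
      ¬ G.Adj b x ∧ ¬ G.Adj c x ∧ ¬ G.Adj b y ∧ ¬ G.Adj c y := by
    obtain ⟨x, y, hxy, h1, h2, h3, h4⟩ := h.edge_bc
    by_cases hx : G.Adj e x
    · exact ⟨x, y, hxy, hx, h1, h2, h3, h4⟩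
    · refine ⟨y, x, hxy.symm, ?_, h3, h4, h1, h2⟩
      by_contra hy
      exact hx ((h.adj_iff hG hxy h1 h2 h3 h4 hae hbe).2 fun h => hy h.symm).symm
  have he'y : G.Adj e' y := by
    by_contra hy
    exact (h.adj_iff hG hxy hbx hcx hby hcy hae hbe).1 hex.symm
      ((hsplit y hcy hby).2 hy).symm
  have key : ∀ p q r t : V, (Finset.univ.filter fun d => ¬ G.Adj c d ∧ ¬ G.Adj b d ∧
      G.Adj r d).card + 2 = 4 → p ≠ q → ¬ G.Adj c p → ¬ G.Adj b p → G.Adj r p →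
      ¬ G.Adj c q → ¬ G.Adj b q → G.Adj r q → ¬ G.Adj c t → ¬ G.Adj b t → G.Adj r t →
      t = p ∨ t = q := by
    intro p q r t hc hpq h1 h2 h3 h4 h5 h6 h7 h8 h9
    have hsub : ({p, q} : Finset V) ⊆ Finset.univ.filter fun d =>
        ¬ G.Adj c d ∧ ¬ G.Adj b d ∧ G.Adj r d := by
      intro s hs
      simp only [Finset.mem_insert, Finset.mem_singleton] at hs
      rcases hs with rfl | rfl <;> simp [*]
    have heq := Finset.eq_of_subset_of_card_le hsub (by rw [Finset.card_pair hpq]; omega)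
    have : t ∈ ({p, q} : Finset V) := by rw [heq]; simp [*]
    simpa using this
  have hwx : w ≠ x := by rintro rfl; exact hw y hcy hby hxy
  have hzy : z ≠ y := by rintro rfl; exact hz x hcx hbx hxy.symm
  refine ⟨x, y, z, w, fun t => ⟨fun ⟨hbt, hct⟩ => ?_, ?_⟩, hxy, fun t h1 h2 => hz t h2 h1,
    fun t h1 h2 => hw t h2 h1, ?_⟩
  · by_cases het : G.Adj e t
    · rcases key w x e t hcard hwx hcw hbw hew hcx hbx hex hct hbt het with h | h <;> simp [h]
    · have he't : G.Adj e' t := by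
        by_contra h
        exact het ((hsplit t hct hbt).2 h)
      rcases key z y e' t hcard' hzy hcz hbz he'z hcy hby he'y hct hbt he't with h | h <;> simp [h]
  · rintro (rfl | rfl | rfl | rfl) <;> exact ⟨by assumption, by assumption⟩
  · rintro rfl
    exact (hsplit z hcz hbz).1 hew he'z

theorem exists_pattern (hA : IsQuad G b c x y z w) (h : IsTri G a b c) (hG : IsLocW2 G 4) :
    ∃ s, ¬ G.Adj a s ∧ ¬ G.Adj b s ∧ G.Adj x s ∧ G.Adj w s ∧ ¬ G.Adj z s := by
  have hy := hA.mem₂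
  have hz := hA.mem₃
  have hw := hA.mem₄
  have hbw : w ≠ b := by rintro rfl; exact hw.2 h.hbc.symm
  have hyz : ¬ G.Adj y z := fun h => hA.iso₁ y hy.1 hy.2 h.symm
  have hyw : ¬ G.Adj y w := fun h => hA.iso₂ y hy.1 hy.2 h.symm
  obtain ⟨s, hsb, -, -, hbs, hys, hzs, hws⟩ := hG.exists_adj₃ hy.1 hz.1 hyz hbw
    (by rintro rfl; exact hA.iso₂ x hA.mem₁.1 hA.mem₁.2 hA.adj.symm) hA.ne.symm hw.1 hyw
    (hA.iso₁ w hw.1 hw.2)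
  rcases h.nb s hbs hsb with has | hcs
  · exact ⟨s, has, hbs, (h.adj_iff hG hA.adj hA.mem₁.1 hA.mem₁.2 hy.1 hy.2 has hbs).2 hys, hws, hzs⟩
  · exact (hA.iso₂ s hbs hcs hws).elim

theorem iso_split [Fintype V] (hA : IsQuad G b c x y z w) (h : IsTri G a b c)
    (hG : IsLocW2 G 4) {u : V} (hau : ¬ G.Adj a u) (hbu : ¬ G.Adj b u) :
    G.Adj w u ↔ ¬ G.Adj z u := by
  classical
  have key : ∀ x y, IsQuad G b c x y z w → G.Adj x u → (G.Adj w u ↔ ¬ G.Adj z u) := by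
    intro x y hA hxu
    obtain ⟨s, has, hbs, hxs, hws, hzs⟩ := hA.exists_pattern h hG
    obtain ⟨t, hat, hbt, hxt, hzt, hwt⟩ := hA.swap_iso.exists_pattern h hG
    have hcard := h.card_add_two hG hA.adj hA.mem₁.1 hA.mem₁.2 hA.mem₂.1 hA.mem₂.2
    have hsub : ({s, t} : Finset V) ⊆ Finset.univ.filter fun d =>
        ¬ G.Adj a d ∧ ¬ G.Adj b d ∧ G.Adj x d := by
      intro r hr
      simp only [Finset.mem_insert, Finset.mem_singleton] at hr
      rcases hr with rfl | rfl <;> simp [*]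
    have heq := Finset.eq_of_subset_of_card_le hsub
      (by rw [Finset.card_pair (by rintro rfl; exact hzs hzt)]; omega)
    have hu : u ∈ ({s, t} : Finset V) := by rw [heq]; simp [*]
    simp only [Finset.mem_insert, Finset.mem_singleton] at hu
    rcases hu with rfl | rfl <;> tauto
  by_cases hxu : G.Adj x u
  · exact key x y hA hxu
  · refine key y x hA.swap_edge ?_
    by_contra hyu
    exact hxu ((h.adj_iff hG hA.adj hA.mem₁.1 hA.mem₁.2 hA.mem₂.1 hA.mem₂.2 hau hbu).2 hyu)

end IsQuad

/-- The adjacencies between `G_{bc}` and `G_{ab}` for a triangle `abc`, when both consist of an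
edge and two isolated vertices. -/
structure IsCross (G : SimpleGraph V) (x y z w e e' d d' : V) : Prop where
  left : ∀ u, (u = e ∨ u = e' ∨ u = d ∨ u = d') →
    (G.Adj y u ↔ ¬ G.Adj x u) ∧ (G.Adj w u ↔ ¬ G.Adj z u)
  right : ∀ v, (v = x ∨ v = y ∨ v = z ∨ v = w) →
    (G.Adj v e' ↔ ¬ G.Adj v e) ∧ (G.Adj v d' ↔ ¬ G.Adj v d)
  cross : ¬ ((G.Adj x e ↔ G.Adj x d) ↔ (G.Adj z e ↔ G.Adj z d))

namespace IsQuad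

variable {G : SimpleGraph V} {a b c x y z w e e' d d' f f' g g' : V}

theorem isCross [Fintype V] (hA : IsQuad G b c x y z w) (hD : IsQuad G a b e e' d d')
    (h : IsTri G a b c) (hG : IsLocW2 G 4) : IsCross G x y z w e e' d d' := by
  have hleft : ∀ u, (u = e ∨ u = e' ∨ u = d ∨ u = d') →
      (G.Adj y u ↔ ¬ G.Adj x u) ∧ (G.Adj w u ↔ ¬ G.Adj z u) := by
    intro u hu
    obtain ⟨hau, hbu⟩ := (hD.mem u).2 hu
    exact ⟨h.adj_iff hG hA.adj.symm hA.mem₂.1 hA.mem₂.2 hA.mem₁.1 hA.mem₁.2 hau hbu,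
      hA.iso_split h hG hau hbu⟩
  have hright : ∀ v, (v = x ∨ v = y ∨ v = z ∨ v = w) →
      (G.Adj v e' ↔ ¬ G.Adj v e) ∧ (G.Adj v d' ↔ ¬ G.Adj v d) := by
    intro v hv
    obtain ⟨hbv, hcv⟩ := (hA.mem v).2 hv
    simp only [G.adj_comm v]
    exact ⟨h.reverse.adj_iff hG hD.adj.symm hD.mem₂.2 hD.mem₂.1 hD.mem₁.2 hD.mem₁.1 hcv hbv,
      hD.symm.iso_split h.reverse hG hcv hbv⟩
  refine ⟨hleft, hright, fun hcon => ?_⟩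
  obtain ⟨s₁, ha₁, hb₁, hs₁⟩ := hA.exists_pattern h hG
  obtain ⟨s₂, ha₂, hb₂, hs₂⟩ := hA.swap_iso.exists_pattern h hG
  obtain ⟨s₃, ha₃, hb₃, hs₃⟩ := hA.swap_edge.exists_pattern h hG
  obtain ⟨s₄, ha₄, hb₄, hs₄⟩ := hA.swap_edge.swap_iso.exists_pattern h hG
  have h₁ := (hD.mem _).1 ⟨ha₁, hb₁⟩
  have h₂ := (hD.mem _).1 ⟨ha₂, hb₂⟩
  have h₃ := (hD.mem _).1 ⟨ha₃, hb₃⟩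
  have h₄ := (hD.mem _).1 ⟨ha₄, hb₄⟩
  have hx := hright x (by simp)
  have hz := hright z (by simp)
  have hl₁ := hleft _ h₁
  have hl₂ := hleft _ h₂
  have hl₃ := hleft _ h₃
  have hl₄ := hleft _ h₄
  grind

end IsQuad

/-- The three graphs `G_{bc}`, `G_{ac}`, `G_{ab}` cannot all consist of an edge and two isolated
vertices: every pattern of adjacencies leaves a triangle undominated. -/
theorem not_isCross {G : SimpleGraph V} {n : ℕ} (hG : IsLocW2 G n)
    {x y z w e e' d d' f f' g g' : V} (hzx : ¬ G.Adj z x) (hwx : ¬ G.Adj w x)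
    (hzw : ¬ G.Adj z w) (hd'e : ¬ G.Adj d' e) (hg'f : ¬ G.Adj g' f)
    (hAD : IsCross G x y z w e e' d d') (hAB : IsCross G x y z w f f' g g')
    (hBD : IsCross G f f' g g' e e' d d')
    (hxe : G.Adj x e) (hxd : G.Adj x d) (hxf : G.Adj x f) (hxg : G.Adj x g)
    (hzd : G.Adj z d) : False := by
  have hze : ¬ G.Adj z e := fun h => hAD.cross (iff_of_true (iff_of_true hxe hxd) (iff_of_true h hzd))
  have hxd' : ¬ G.Adj x d' := fun h => ((hAD.right x (by simp)).2.1 h) hxd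
  have hxg' : ¬ G.Adj x g' := fun h => ((hAB.right x (by simp)).2.1 h) hxg
  have hzd' : ¬ G.Adj z d' := fun h => ((hAD.right z (by simp)).2.1 h) hzd
  have hwe : G.Adj w e := (hAD.left e (by simp)).2.2 hze
  have hwd : ¬ G.Adj w d := fun h => (hAD.left d (by simp)).2.1 h hzd
  have hwd' : G.Adj w d' := (hAD.left d' (by simp)).2.2 hzd'
  have hwe' : ¬ G.Adj w e' := fun h => ((hAD.right w (by simp)).1.1 h) hwe
  have hze' : G.Adj z e' := (hAD.right z (by simp)).1.2 hze
  have hzfg : G.Adj z f ↔ ¬ G.Adj z g :=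
    ⟨fun h h' => hAB.cross (iff_of_true (iff_of_true hxf hxg) (iff_of_true h h')), fun h =>
      by_contra fun h' => hAB.cross (iff_of_true (iff_of_true hxf hxg) (iff_of_false h' h))⟩
  have hwf := (hAB.left f (by simp)).2
  have hwg := (hAB.left g (by simp)).2
  have hwg' := (hAB.right w (by simp)).2
  have hfe' := (hBD.right f (by simp)).1
  have hfd' := (hBD.right f (by simp)).2
  have hg'e := (hBD.left e (by simp)).2
  have hg'd := (hBD.left d (by simp)).2
  have hgd' := (hBD.right g (by simp)).2
  have hcross := hBD.cross
  by_cases hfe : G.Adj f e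
  · have hdom := hG.dom x e f hxe hfe.symm hxf
    have hfd'' : G.Adj f d' := by
      rcases hdom d' with h | h | h
      exacts [(hxd' h.symm).elim, (hd'e h).elim, h.symm]
    have hzf : G.Adj z f := by
      rcases hdom z with h | h | h
      exacts [(hzx h).elim, (hze h).elim, h]
    have hg'e' : G.Adj g' e := by
      rcases hdom g' with h | h | h
      exacts [(hxg' h.symm).elim, h, (hg'f h).elim]
    have hgd'' : G.Adj g d' := hgd'.2 fun hgd => hcross
      ⟨fun h => (hfd'.1 hfd'' (h.1 hfe)).elim, fun h => (hg'e.1 hg'e' (h.2 hgd)).elim⟩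
    rcases hG.dom w d' g hwd' hgd''.symm (hwg.2 (hzfg.1 hzf)) z with h | h | h
    exacts [hzw h, hzd' h, hzfg.1 hzf h]
  · by_cases hfd : G.Adj f d
    · have hdom := hG.dom x f d hxf hfd hxd
      have hwf' : G.Adj w f := by
        rcases hdom w with h | h | h
        exacts [(hwx h).elim, h, (hwd h).elim]
      have hg'd' : G.Adj g' d := by
        rcases hdom g' with h | h | h
        exacts [(hxg' h.symm).elim, (hg'f h).elim, h]
      have hwg'' : G.Adj w g' := hwg'.2 fun h => hwf.1 hwf' (hzfg.2 (hwg.1 h))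
      have hg'e' : G.Adj g' e := hg'e.2 fun hge => hcross
        ⟨fun h => (hfe (h.2 hfd)).elim, fun h => (hg'd.1 hg'd' (h.1 hge)).elim⟩
      rcases hG.dom w g' e hwg'' hg'e' hwe z with h | h | h
      · exact hzw h
      · exact (hAB.left g' (by simp)).2.1 hwg'' h
      · exact hze h
    · by_cases hzf : G.Adj z f
      · rcases hG.dom z f e' hzf (hfe'.2 hfe) hze' w with h | h | h
        exacts [hzw h.symm, hwf.1 h hzf, hwe' h]
      · rcases hG.dom w f d' (hwf.2 hzf) (hfd'.2 hfd) hwd' z with h | h | h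
        exacts [hzw h, hzf h, hzd' h]

theorem not_isTri [Fintype V] {G : SimpleGraph V} {n : ℕ} {a b c : V} (hG : IsLocW2 G n)
    (hn : 4 ≤ n) (h : IsTri G a b c) : False := by
  obtain rfl := h.eq_four hG hn
  obtain ⟨x, y, z, w, hA⟩ := IsQuad.exists_of_isTri h hG
  obtain ⟨f, f', g, g', hB⟩ := IsQuad.exists_of_isTri h.swap hG
  obtain ⟨e, e', d, d', hD⟩ := IsQuad.exists_of_isTri h.swap.reverse hG
  have hl := fun e e' d d' (hD : IsQuad G a b e e' d d') => (hA.isCross hD h hG).right x (by simp)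
  have hr := fun f f' g g' (hB : IsQuad G a c f f' g g') =>
    (hA.symm.isCross hB h.swap.reverse.swap hG).right x (by simp)
  wlog hxe : G.Adj x e generalizing e e'
  · exact this e' e hD.swap_edge ((hl _ _ _ _ hD).1.2 hxe)
  wlog hxd : G.Adj x d generalizing d d'
  · exact this d' d hD.swap_iso ((hl _ _ _ _ hD).2.2 hxd)
  wlog hxf : G.Adj x f generalizing f f'
  · exact this f' f hB.swap_edge ((hr _ _ _ _ hB).1.2 hxf)
  wlog hxg : G.Adj x g generalizing g g'
  · exact this g' g hB.swap_iso ((hr _ _ _ _ hB).2.2 hxg)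
  clear hl hr
  wlog hzd : G.Adj z d generalizing z w
  · exact this w z hA.swap_iso (((hA.isCross hD h hG).left d (by simp)).2.2 hzd)
  exact not_isCross hG (hA.iso₁ x hA.mem₁.1 hA.mem₁.2) (hA.iso₂ x hA.mem₁.1 hA.mem₁.2)
    (hA.iso₁ w hA.mem₄.1 hA.mem₄.2) (hD.iso₂ e hD.mem₁.1 hD.mem₁.2)
    (hB.iso₂ f hB.mem₁.1 hB.mem₁.2) (hA.isCross hD h hG)
    (hA.symm.isCross hB h.swap.reverse.swap hG) (hB.isCross hD.symm h.swap hG)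
    hxe hxd hxf hxg hzd

/-- The structure of `N_G(a) \ N_G[b]` and `G_{ab}` around an edge `xy` of the former, when the
independence number is three. -/
theorem IsLocW2.structure_of_three [Fintype V] {G : SimpleGraph V} {a b x y d₀ : V}
    (hG : IsLocW2 G 3) (hab : G.Adj a b) (hxy : G.Adj x y) (hax : G.Adj a x) (hay : G.Adj a y)
    (hbx : ¬ G.Adj b x) (hby : ¬ G.Adj b y) (had₀ : ¬ G.Adj a d₀) (hbd₀ : ¬ G.Adj b d₀) :
    (∃ z, ¬ G.Adj x z ∧ ¬ G.Adj y z ∧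
      ∀ v, (G.Adj a v ∧ v ≠ b ∧ ¬ G.Adj b v) ↔ v = x ∨ v = y ∨ v = z) ∧
    ∃ d₁ d₂, d₁ ≠ d₂ ∧ ¬ G.Adj d₁ d₂ ∧
      ∀ v, (¬ G.Adj a v ∧ ¬ G.Adj b v) ↔ v = d₁ ∨ v = d₂ := by
  classical
  obtain ⟨hcx, ⟨d₂, had₂, hbd₂, hyd₂, hd₂, -⟩, hx⟩ :=
    hG.edge_structure hab hxy hax hay hbx hby had₀ hbd₀
  obtain ⟨hcy, ⟨d₁, had₁, hbd₁, hxd₁, -, -⟩, hy⟩ :=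
    hG.edge_structure hab hxy.symm hay hax hby hbx had₀ hbd₀
  have hsplit : ∀ d, ¬ G.Adj a d → ¬ G.Adj b d → (G.Adj x d ↔ ¬ G.Adj y d) :=
    fun d => hG.adj_iff_not_adj hxy hax hay hbx hby
  have hxd₂ : ¬ G.Adj x d₂ := fun h => (hsplit d₂ had₂ hbd₂).1 h hyd₂
  have hxb : x ≠ b := by rintro rfl; exact hby hxy
  have hyb : y ≠ b := by rintro rfl; exact hbx hxy.symm
  have hd₂b : d₂ ≠ b := by rintro rfl; exact had₂ hab
  have hd₂x : d₂ ≠ x := by rintro rfl; exact had₂ hax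
  constructor
  · obtain ⟨z, hzb, hzx, hbz, hxz, hd₂z⟩ := hG.exists_adj₂ hbx hd₂b hd₂x hbd₂ hxd₂
    have haz : G.Adj a z := by
      by_contra haz
      exact hd₂ z haz hbz hd₂z
    have hyz : ¬ G.Adj y z := fun h => hzx (hy z haz hbz hzb h)
    have hzy : z ≠ y := by rintro rfl; exact hxz hxy
    refine ⟨z, hxz, hyz, fun v => ⟨fun ⟨hav, hvb, hbv⟩ => ?_, ?_⟩⟩
    · by_contra! hcon
      obtain ⟨hvx, hvy, hvz⟩ := hcon
      have hxv : ¬ G.Adj x v := fun h => hvy (hx v hav hbv hvb h)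
      have hIbx : ∀ u ∈ ({b, x} : Finset V), ∀ w ∈ ({b, x} : Finset V), ¬ G.Adj u w := by
        simp [hbx, G.adj_comm x b]
      have key : ∀ p q, ¬ G.Adj b p → ¬ G.Adj x p → ¬ G.Adj b q → ¬ G.Adj x q → p ≠ b → p ≠ x →
          q ≠ b → q ≠ x → p ≠ q → G.Adj p q := by
        intro p q h1 h2 h3 h4 h5 h6 h7 h8 h9
        by_contra hpq
        have := hG.card_lt (S := {p, b, x}) (v := q)
          (indep_insert hIbx (by simp [h1, h2])) (by grind) (by grind)
        rw [Finset.card_insert_of_notMem (by simp [h5, h6]), Finset.card_pair hxb.symm] at this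
        omega
      have hzv := key z v hbz hxz hbv hxv hzb hzx hvb hvx hvz.symm
      have hd₂v := key d₂ v hbd₂ hxd₂ hbv hxv hd₂b hd₂x hvb hvx (by rintro rfl; exact had₂ hav)
      rcases hG.dom z v d₂ hzv hd₂v.symm hd₂z.symm b with h | h | h
      exacts [hbz h, hbv h, hbd₂ h]
    · rintro (rfl | rfl | rfl) <;> exact ⟨by assumption, by assumption, by assumption⟩
  · refine ⟨d₁, d₂, by rintro rfl; exact hxd₂ hxd₁, fun h => hd₂ d₁ had₁ hbd₁ h.symm,
      fun v => ⟨fun ⟨hav, hbv⟩ => ?_, ?_⟩⟩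
    · by_cases hxv : G.Adj x v
      · exact Or.inl (Finset.card_le_one.1 (Nat.le_of_add_le_add_right hcx.le)
          v (Finset.mem_filter_univ _ |>.2 ⟨hav, hbv, hxv⟩)
          d₁ (Finset.mem_filter_univ _ |>.2 ⟨had₁, hbd₁, hxd₁⟩))
      · have hyv : G.Adj y v := by
          by_contra h
          exact hxv ((hsplit v hav hbv).2 h)
        exact Or.inr (Finset.card_le_one.1 (Nat.le_of_add_le_add_right hcy.le)
          v (Finset.mem_filter_univ _ |>.2 ⟨hav, hbv, hyv⟩)
          d₂ (Finset.mem_filter_univ _ |>.2 ⟨had₂, hbd₂, hyd₂⟩))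
    · rintro (rfl | rfl) <;> exact ⟨by assumption, by assumption⟩

/-- If `A = N_G(a) \ N_G[b]` is not independent, then `α(G) = 3`, `G[A]` is one
edge plus one isolated vertex, and `G_{ab}` is exactly two isolated vertices. -/
theorem stmt_16 [Fintype V] (G : SimpleGraph V) (h2 : W2 G)
    (hloc : LocallyTriangleFree G) (hα : 3 ≤ indepNum G) (hjoin : ¬ IsJoin G)
    {a b c : V} (hab : G.Adj a b) (hbc : G.Adj b c) (hac : G.Adj a c)
    (hA : ¬ IsIndepOn G Set.univ (G.neighborSet a \ nbhd G {b})) :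
    indepNum G = 3 ∧
    (∃ x y z : V, G.neighborSet a \ nbhd G {b} = {x, y, z} ∧
      x ≠ y ∧ x ≠ z ∧ y ≠ z ∧ G.Adj x y ∧ ¬ G.Adj x z ∧ ¬ G.Adj y z) ∧
    ((GDel G {a, b}).ncard = 2 ∧
      ∀ u ∈ GDel G {a, b}, ∀ w ∈ GDel G {a, b}, ¬ G.Adj u w) := by
  have hG := isLocW2_of_W2 G h2 hloc
  have hmemA : ∀ v, v ∈ G.neighborSet a \ nbhd G {b} ↔ G.Adj a v ∧ v ≠ b ∧ ¬ G.Adj b v := by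
    simp [nbhd]
  have hmemD : ∀ v, v ∈ GDel G {a, b} ↔ ¬ G.Adj a v ∧ ¬ G.Adj b v := by
    intro v
    simp only [GDel, nbhd, Set.mem_sdiff, Set.mem_univ, true_and]
    grind [G.adj_comm]
  obtain ⟨x, hx, y, hy, hxy⟩ : ∃ x ∈ G.neighborSet a \ nbhd G {b},
      ∃ y ∈ G.neighborSet a \ nbhd G {b}, G.Adj x y := by
    by_contra! hcon
    exact hA ⟨Set.subset_univ _, hcon⟩
  obtain ⟨hax, -, hbx⟩ := (hmemA x).1 hx
  obtain ⟨hay, -, hby⟩ := (hmemA y).1 hy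
  obtain ⟨d₀, had₀, hbd₀⟩ := hG.exists_not_adj_of_not_isJoin hα hjoin hab hac hbc
  have hn : indepNum G = 3 := by
    by_contra hne
    have hn : 4 ≤ indepNum G := by omega
    exact not_isTri hG hn (IsTri.of_edge hG hn hjoin hab hbc hac hxy hax hay hbx hby)
  rw [hn] at hG
  obtain ⟨⟨z, hxz, hyz, hAz⟩, d₁, d₂, hne, hd, hD⟩ :=
    hG.structure_of_three hab hxy hax hay hbx hby had₀ hbd₀
  have hDeq : GDel G {a, b} = {d₁, d₂} := by
    ext v
    rw [hmemD, hD]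
    simp
  refine ⟨hn, ⟨x, y, z, ?_, hxy.ne, ?_, ?_, hxy, hxz, hyz⟩, ?_, ?_⟩
  · ext v
    rw [hmemA, hAz]
    simp
  · rintro rfl
    exact hyz hxy.symm
  · rintro rfl
    exact hxz hxy
  · rw [hDeq, Set.ncard_pair hne]
  · rw [hDeq]
    simp [hd, G.adj_comm d₂ d₁]
end
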